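/- Let n = mℓ, let 1 ≤ s ≤ ℓ, and let d divide n. If d divides both s and ℓ, then the number of (m+2)-angulations of P_n^• with s spokes fixed under rotation by 2π/d equals m · C(n/d + ℓ/d - s/d - 1, n/d - 1); if s ≢ ℓ (mod d), or s ≡ ℓ ≡ 0 handled above, and in the case s ≢ ℓ (mod d) the count of fixed points is t^{(m)}_{n,s}(ζ_d) = 0, where t^{(m)}_{n,s}(q) = m·[n+ℓ-s-1 choose n-1]_q. More precisely: if s and ℓ are not congruent to the same nonzero residue mod d, then the evaluation t^{(m)}_{n,s}(ζ_d) equals the number of such fixed (m+2)-angulations. -/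

import Mathlib

open Polynomial in
/-- The Gaussian binomial coefficient `[n choose k]_q` as an integer polynomial in `q`,
defined via the `q`-Pascal recursion
`[n+1 choose k+1]_q = [n choose k]_q + q^{k+1}·[n choose k+1]_q`;
it equals `[n]_q!/([k]_q!·[n-k]_q!)`. -/
noncomputable def qbinom : ℕ → ℕ → Polynomial ℤ
  | _, 0 => 1
  | 0, _ + 1 => 0
  | n + 1, k + 1 => qbinom n k + X ^ (k + 1) * qbinom n (k + 1)


/-- An arc on the once-punctured polygon `P_n^•`: either a spoke from boundary
vertex `i` to the puncture, or the peripheral arc from `i` clockwise to `j`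
(cut off region without the puncture); `per i i` is the loop at `i` cutting out a
once-punctured monogon. -/
inductive PArc (n : ℕ) where
  | spoke (i : Fin n)
  | per (i j : Fin n)
deriving DecidableEq

namespace PArc

/-- Clockwise distance from `i` to `j` on the boundary. -/
def gp (n : ℕ) (i j : Fin n) : ℕ := (j.val + n - i.val) % n

/-- The clockwise length of the peripheral arc from `i` to `j` (`n` for the loop). -/
def len (n : ℕ) (i j : Fin n) : ℕ := if i = j then n else (j.val + n - i.val) % n

/-- An arc is valid (not isotopic to a boundary segment). -/
def Valid {n : ℕ} : PArc n → Prop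
  | .spoke _ => True
  | .per i j => 2 ≤ len n i j

/-- Two arcs cross (have essential intersection); computed via their lifts to the
universal cover (an infinite strip with vertices `ℤ`, a peripheral arc `per i j`
lifting to chords `(a, a + len i j)` for `a ≡ i (mod n)` and a spoke lifting to
downward rays at positions `≡ i (mod n)`). -/
def Cross {n : ℕ} : PArc n → PArc n → Prop
  | .spoke _, .spoke _ => False
  | .spoke s, .per i j => 0 < gp n i s ∧ gp n i s < len n i j
  | .per i j, .spoke s => 0 < gp n i s ∧ gp n i s < len n i j
  | .per i j, .per k l =>
      (0 < gp n i k ∧ gp n i k < len n i j ∧ len n i j < gp n i k + len n k l) ∨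
      (0 < gp n k i ∧ gp n k i < len n k l ∧ len n k l < gp n k i + len n i j)

def isSpoke {n : ℕ} : PArc n → Bool
  | .spoke _ => true
  | .per _ _ => false

end PArc

/-- `(a, b)` is a lift (to the strip with vertices `ℤ`) of a peripheral arc of `T`. -/
def IsChord {n : ℕ} (T : Finset (PArc n)) (a b : ℤ) : Prop :=
  ∃ i j : Fin n, PArc.per i j ∈ T ∧ ∃ t : ℤ, a = (i.val : ℤ) + t * n ∧ b = a + PArc.len n i j

/-- `a` is the position of a lift of a spoke of `T`. -/
def IsRay {n : ℕ} (T : Finset (PArc n)) (a : ℤ) : Prop :=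
  ∃ s : Fin n, PArc.spoke s ∈ T ∧ ∃ t : ℤ, a = (s.val : ℤ) + t * n

/-- `a` and `b` are joined by a boundary edge or a lifted chord. -/
def IsEdge {n : ℕ} (T : Finset (PArc n)) (a b : ℤ) : Prop :=
  b = a + 1 ∨ IsChord T a b

/-- `a < b` are consecutive elements of `S`. -/
def ConsecIn (S : Finset ℤ) (a b : ℤ) : Prop :=
  a ∈ S ∧ b ∈ S ∧ a < b ∧ ∀ x ∈ S, ¬(a < x ∧ x < b)

/-- `S` is the vertex set of a finite face (a subgon not containing the puncture)
of the lift of `T` to the strip. -/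
def IsFinFace {n : ℕ} (T : Finset (PArc n)) (S : Finset ℤ) : Prop :=
  3 ≤ S.card ∧
  (∀ u v : ℤ, ConsecIn S u v → IsEdge T u v) ∧
  (∃ a ∈ S, ∃ b ∈ S, (∀ x ∈ S, a ≤ x ∧ x ≤ b) ∧ IsChord T a b ∧
    ∀ u ∈ S, ∀ v ∈ S, u < v → IsChord T u v → (u = a ∧ v = b) ∨ ConsecIn S u v)

/-- Vertex `x` of the strip is strictly covered by some lifted chord of `T`. -/
def Covered {n : ℕ} (T : Finset (PArc n)) (x : ℤ) : Prop :=
  ∃ a b : ℤ, IsChord T a b ∧ a < x ∧ x < b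

/-- `T` is an `(m+2)`-angulation of the once-punctured polygon `P_n^•`: a set of
pairwise noncrossing valid arcs, containing a spoke, all of whose finite faces are
`(m+2)`-gons, and all of whose faces at the puncture (those between consecutive
spoke lifts, with the puncture as one extra vertex) are `(m+2)`-gons. -/
def IsAngulation (n m : ℕ) (T : Finset (PArc n)) : Prop :=
  (∀ a ∈ T, PArc.Valid a) ∧
  (∀ a ∈ T, ∀ b ∈ T, a ≠ b → ¬ PArc.Cross a b) ∧
  (∃ s : Fin n, PArc.spoke s ∈ T) ∧
  (∀ S : Finset ℤ, IsFinFace T S → S.card = m + 2) ∧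
  (∀ a b : ℤ, IsRay T a → IsRay T b → a < b → (∀ x : ℤ, a < x → x < b → ¬ IsRay T x) →
    Nat.card {x : ℤ // a ≤ x ∧ x ≤ b ∧ ¬ Covered T x} = m + 1)

/-- The number of spokes of `T`. -/
def spokeCount {n : ℕ} (T : Finset (PArc n)) : ℕ := (T.filter (fun a => a.isSpoke)).card

/-- Counterclockwise rotation of arcs by `c` vertex positions (`v_i ↦ v_{i-c}`). -/
def rotArc {n : ℕ} (c : Fin n) : PArc n → PArc n
  | .spoke i => .spoke (i - c)
  | .per i j => .per (i - c) (j - c)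




section QPart
open Polynomial

noncomputable def qb (ζ : ℂ) (n k : ℕ) : ℂ := Polynomial.aeval ζ (qbinom n k)

theorem qb_zero (ζ : ℂ) (n : ℕ) : qb ζ n 0 = 1 := by
  unfold qb; cases n <;> simp [qbinom]

theorem qb_zero_succ (ζ : ℂ) (k : ℕ) : qb ζ 0 (k+1) = 0 := by
  unfold qb; simp [qbinom]

theorem qb_succ (ζ : ℂ) (n k : ℕ) :
    qb ζ (n+1) (k+1) = qb ζ n k + ζ^(k+1) * qb ζ n (k+1) := by
  unfold qb; simp [qbinom]

theorem qb_lt (ζ : ℂ) (n k : ℕ) (h : n < k) : qb ζ n k = 0 := by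
  induction n generalizing k with
  | zero => obtain ⟨k, rfl⟩ : ∃ j, k = j+1 := ⟨k-1, by omega⟩; exact qb_zero_succ _ _
  | succ n ih =>
    obtain ⟨k, rfl⟩ : ∃ j, k = j+1 := ⟨k-1, by omega⟩
    rw [qb_succ, ih _ (by omega), ih _ (by omega)]; simp

theorem qb_self (ζ : ℂ) (n : ℕ) : qb ζ n n = 1 := by
  induction n with
  | zero => exact qb_zero _ _
  | succ n ih => rw [qb_succ, ih, qb_lt _ _ _ (by omega)]; simp

theorem qb_absorb (ζ : ℂ) (n k : ℕ) :
    (1 - ζ^(k+1)) * qb ζ (n+1) (k+1) = (1 - ζ^(n+1)) * qb ζ n k := by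
  induction n generalizing k with
  | zero =>
    rw [qb_succ, qb_zero_succ]
    cases k with
    | zero => simp
    | succ k => simp [qb_zero_succ]
  | succ n ih =>
    rw [qb_succ]
    have h1 := ih k
    cases k with
    | zero =>
      simp only [qb_zero] at *
      linear_combination ζ * h1
    | succ k =>
      have h2 := ih k
      have h3 := qb_succ ζ n k
      linear_combination ζ^(k+1+1) * h1 - ζ * (1 - ζ^(n+1)) * h3 + ζ * h2

theorem qb_prim (ζ : ℂ) (d : ℕ) (hζ : IsPrimitiveRoot ζ d) (j : ℕ) (h0 : 0 < j) (hj : j < d) :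
    qb ζ d j = 0 := by
  obtain ⟨j, rfl⟩ : ∃ i, j = i+1 := ⟨j-1, by omega⟩
  obtain ⟨d, rfl⟩ : ∃ i, d = i+1 := ⟨d-1, by omega⟩
  have h := qb_absorb ζ d j
  rw [hζ.pow_eq_one] at h
  have h2 : (1 - ζ^(j+1)) ≠ 0 := by
    intro h3
    exact hζ.pow_ne_one_of_pos_of_lt (by omega) hj (by linear_combination -h3)
  simpa [h2] using h

theorem qb_add (ζ : ℂ) (d : ℕ) (hd : 0 < d) (hζ : IsPrimitiveRoot ζ d) (N : ℕ) :
    (∀ k, k < d → qb ζ (N+d) k = qb ζ N k) ∧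
    (∀ k, qb ζ (N+d) (k+d) = qb ζ N k + qb ζ N (k+d)) := by
  induction N with
  | zero =>
    constructor
    · intro k hk
      rcases Nat.eq_zero_or_pos k with rfl | h
      · simp [qb_zero]
      · rw [zero_add, qb_prim ζ d hζ k h hk, qb_lt _ _ _ h]
    · intro k
      rcases Nat.eq_zero_or_pos k with rfl | h
      · simp [qb_self, qb_lt _ _ _ hd]
      · rw [qb_lt _ _ _ (by omega), qb_lt _ _ _ h, qb_lt _ _ _ (by omega)]; simp
  | succ N ih =>
    obtain ⟨ih1, ih2⟩ := ih
    constructor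
    · intro k hk
      cases k with
      | zero => simp [qb_zero]
      | succ k =>
        rw [show N + 1 + d = (N + d) + 1 by ring, qb_succ, qb_succ, ih1 _ hk, ih1 _ (by omega)]
    · intro k
      cases k with
      | zero =>
        obtain ⟨e, rfl⟩ : ∃ i, d = i+1 := ⟨d-1, by omega⟩
        have h := ih2 0
        rw [zero_add] at *
        rw [show N + 1 + (e+1) = (N + (e+1)) + 1 by ring, qb_succ, qb_succ ζ N e, ih1 _ (by omega), h,
          hζ.pow_eq_one]
        simp only [qb_zero]; ring
      | succ k =>
        rw [show N + 1 + d = (N + d) + 1 by ring, show k + 1 + d = (k + d) + 1 by ring, qb_succ,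
          qb_succ, qb_succ, show (k + d) + 1 = (k+1) + d by ring, ih2, ih2]
        have : ζ^(k+1+d) = ζ^(k+1) := by rw [pow_add, hζ.pow_eq_one, mul_one]
        rw [this]; ring

theorem qb_lucas (ζ : ℂ) (d : ℕ) (hd : 0 < d) (hζ : IsPrimitiveRoot ζ d) (r t a b : ℕ) (hr : r < d)
    (ht : t < d) : qb ζ (a*d+r) (b*d+t) = (a.choose b : ℂ) * qb ζ r t := by
  induction a generalizing b with
  | zero =>
    cases b with
    | zero => simp
    | succ b => rw [qb_lt _ _ _ (by nlinarith)]; simp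
  | succ a ih =>
    obtain ⟨h1, h2⟩ := qb_add ζ d hd hζ (a*d+r)
    rw [show (a+1)*d + r = a*d+r+d by ring]
    cases b with
    | zero => simpa using (h1 t ht).trans (by simpa using ih 0)
    | succ b =>
      rw [show (b+1)*d+t = (b*d+t)+d by ring, h2, show (b*d+t)+d = (b+1)*d+t by ring, ih, ih,
        Nat.choose_succ_succ]
      push_cast; ring

theorem qb_final_div (ζ : ℂ) (d : ℕ) (hd : 0 < d) (hζ : IsPrimitiveRoot ζ d) (N K : ℕ) (hN : 0 < N) :
    qb ζ (N*d + K*d - 1) (N*d - 1) = ((N + K - 1).choose (N-1) : ℂ) := by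
  obtain ⟨N, rfl⟩ : ∃ i, N = i+1 := ⟨N-1, by omega⟩
  have h1 : (N+1)*d + K*d - 1 = (N+K)*d + (d-1) := by
    have : (N+1)*d + K*d = (N+K)*d + d := by ring
    omega
  have h2 : (N+1)*d - 1 = N*d + (d-1) := by
    have : (N+1)*d = N*d + d := by ring
    omega
  rw [h1, h2, qb_lucas ζ d hd hζ _ _ _ _ (by omega) (by omega), qb_self, mul_one]
  congr 2; omega

theorem qb_final_ndiv (ζ : ℂ) (d : ℕ) (hd : 0 < d) (hζ : IsPrimitiveRoot ζ d) (N k : ℕ) (hN : 0 < N)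
    (hk : ¬ d ∣ k) :
    qb ζ (N*d + k - 1) (N*d - 1) = 0 := by
  obtain ⟨N, rfl⟩ : ∃ i, N = i+1 := ⟨N-1, by omega⟩
  have h0 : k % d ≠ 0 := fun h => hk (Nat.dvd_of_mod_eq_zero h)
  have h3 := Nat.mod_lt k hd
  have h4 := Nat.div_add_mod' k d
  have h1 : (N+1)*d + k - 1 = (N+1+k/d)*d + (k%d-1) := by
    have : (N+1+k/d)*d = (N+1)*d + k/d*d := by ring
    omega
  have h2 : (N+1)*d - 1 = N*d + (d-1) := by
    have : (N+1)*d = N*d + d := by ring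
    omega
  rw [h1, h2, qb_lucas ζ d hd hζ _ _ _ _ (by omega) (by omega), qb_lt _ _ _ (by omega), mul_zero]

end QPart


section AbsPart
open Finset


noncomputable def GG (f : ℤ → ℕ) (x : ℤ) : ℤ := ∑ i ∈ Finset.Ico 0 x, (f i : ℤ) - ∑ i ∈ Finset.Ico x 0, (f i : ℤ)

theorem GG_succ (f : ℤ → ℕ) (x : ℤ) : GG f (x+1) = GG f x + f x := by
  unfold GG
  rcases le_or_gt 0 x with h | h
  · have h1 : Finset.Ico x 0 = ∅ := Finset.Ico_eq_empty (by omega)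
    have h2 : Finset.Ico (x+1) 0 = ∅ := Finset.Ico_eq_empty (by omega)
    have h3 : Finset.Ico 0 (x+1) = insert x (Finset.Ico 0 x) := by
      ext y; simp only [Finset.mem_insert, Finset.mem_Ico]; omega
    rw [h1, h2, h3, Finset.sum_insert (by simp)]; simp; ring
  · have h1 : Finset.Ico 0 x = ∅ := Finset.Ico_eq_empty (by omega)
    have h2 : Finset.Ico 0 (x+1) = ∅ := Finset.Ico_eq_empty (by omega)
    have h3 : Finset.Ico x 0 = insert x (Finset.Ico (x+1) 0) := by
      ext y; simp only [Finset.mem_insert, Finset.mem_Ico]; omega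
    rw [h1, h2, h3, Finset.sum_insert (by simp)]; simp

noncomputable def FF (m : ℕ) (f : ℤ → ℕ) (x : ℤ) : ℤ := x - m * GG f x

theorem FF_succ (m : ℕ) (f : ℤ → ℕ) (x : ℤ) : FF m f (x+1) = FF m f x + 1 - m * f x := by
  unfold FF; rw [GG_succ]; ring

theorem const_of_step (D : ℤ → ℤ) (h : ∀ x, D (x+1) = D x) (x : ℤ) : D x = D 0 := by
  induction x using Int.induction_on with
  | zero => rfl
  | succ i ih => rw [h, ih]
  | pred i ih => rw [← ih, ← h (-(i:ℤ)-1)]; congr 1; ring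

theorem FF_add (m : ℕ) (f : ℤ → ℕ) (p : ℤ) (hf : ∀ x, f (x+p) = f x) (x : ℤ) :
    FF m f (x+p) = FF m f x + (p - m * GG f p) := by
  have h := const_of_step (fun x => FF m f (x+p) - FF m f x) (by
    intro x
    show FF m f (x+1+p) - FF m f (x+1) = FF m f (x+p) - FF m f x
    rw [show x + 1 + p = (x+p)+1 by ring, FF_succ, FF_succ, hf]; ring) x
  simp only [zero_add] at h
  have h0 : FF m f p = p - m * GG f p := rfl
  have h1 : FF m f 0 = 0 := by simp [FF, GG]
  rw [h0, h1] at h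
  linarith

theorem per_mul (F : ℤ → ℤ) (n D : ℤ) (hp : ∀ x, F (x+n) = F x + D) (x t : ℤ) :
    F (x + t * n) = F x + t * D := by
  induction t using Int.induction_on with
  | zero => simp
  | succ i ih => rw [show x + (i+1) * n = x + i*n + n by ring, hp, ih]; ring
  | pred i ih =>
    have := hp (x + (-(i:ℤ)-1)*n)
    rw [show x + (-(i:ℤ)-1)*n + n = x + -(i:ℤ)*n by ring, ih] at this
    linarith

theorem skip_le (F : ℤ → ℤ) (hF : ∀ x, F (x+1) ≤ F x + 1) (x : ℤ) (k : ℕ) : F (x+k) ≤ F x + k := by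
  induction k with
  | zero => simp
  | succ k ih => have := hF (x+k); push_cast; rw [← add_assoc]; linarith

theorem F_unbdd (F : ℤ → ℤ) (n D : ℤ) (hn : 0 < n) (hD : 0 < D) (hp : ∀ x, F (x+n) = F x + D)
    (a L : ℤ) : ∃ z, a < z ∧ L ≤ F z := by
  refine ⟨a + (|L - F a| + 1) * n, ?_, ?_⟩
  · have := abs_nonneg (L - F a); nlinarith
  · rw [per_mul F n D hp]
    have := abs_nonneg (L - F a)
    have := le_abs_self (L - F a); nlinarith

theorem F_bdd (F : ℤ → ℤ) (n D : ℤ) (hn : 0 < n) (hD : 0 < D) (hp : ∀ x, F (x+n) = F x + D)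
    (hF : ∀ x, F (x+1) ≤ F x + 1) (L : ℤ) : ∃ b, ∀ z, L ≤ F z → b ≤ z := by
  refine ⟨-|L - F 0 - n| * n, fun z hz => ?_⟩
  have h1 := Int.emod_add_mul_ediv z n
  have h2 := Int.emod_nonneg z hn.ne'
  have h3 := Int.emod_lt_of_pos z hn
  have h4 : F z = F (z % n) + (z / n) * D := by
    rw [← per_mul F n D hp]; congr 1; linarith
  have h5 := skip_le F hF 0 (z % n).toNat
  rw [Int.toNat_of_nonneg h2, zero_add] at h5
  have h6 : -|L - F 0 - n| ≤ z / n := by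
    by_contra hc
    push Not at hc
    have := abs_nonneg (L - F 0 - n)
    have := neg_abs_le (L - F 0 - n)
    nlinarith
  nlinarith

theorem first_hit (F : ℤ → ℤ) (hF : ∀ x, F (x+1) ≤ F x + 1) (a L : ℤ) (h : F (a+1) ≤ L)
    (hex : ∃ z, a < z ∧ L ≤ F z) : ∃ e, a < e ∧ F e = L ∧ ∀ y, a < y → y < e → F y < L := by
  obtain ⟨e, ⟨h1, h2⟩, h3⟩ := Int.exists_least_of_bdd (P := fun z => a < z ∧ L ≤ F z)
    ⟨a, fun z hz => hz.1.le⟩ hex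
  have h4 : ∀ y, a < y → y < e → F y < L := by
    intro y hy hye
    by_contra hc
    have := h3 y ⟨hy, not_lt.1 hc⟩
    omega
  refine ⟨e, h1, ?_, h4⟩
  rcases eq_or_lt_of_le (show a + 1 ≤ e by omega) with h5 | h5
  · subst h5; omega
  · have := h4 (e-1) (by omega) (by omega)
    have := hF (e-1)
    rw [sub_add_cancel] at this
    omega

def Rec (F : ℤ → ℤ) (x : ℤ) : Prop := ∀ y, y < x → F y < F x

theorem rec_exists (F : ℤ → ℤ) (n D : ℤ) (hn : 0 < n) (hD : 0 < D) (hp : ∀ x, F (x+n) = F x + D)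
    (hF : ∀ x, F (x+1) ≤ F x + 1) (L : ℤ) : ∃ x, F x = L ∧ Rec F x := by
  obtain ⟨e, h2, h3⟩ := Int.exists_least_of_bdd (P := fun z => L ≤ F z)
    (F_bdd F n D hn hD hp hF L) (by
      obtain ⟨z, _, hz⟩ := F_unbdd F n D hn hD hp 0 L
      exact ⟨z, hz⟩)
  have h4 : ∀ y, y < e → F y < L := by
    intro y hye
    by_contra hc
    have := h3 y (not_lt.1 hc)
    omega
  have h5 := h4 (e-1) (by omega)
  have := hF (e-1)
  rw [sub_add_cancel] at this
  have h6 : F e = L := by omega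
  exact ⟨e, h6, fun y hy => by rw [h6]; exact h4 y hy⟩

theorem rec_lt_iff (F : ℤ → ℤ) {x y : ℤ} (hx : Rec F x) (hy : Rec F y) : x < y ↔ F x < F y := by
  constructor
  · exact hy x
  · intro h
    by_contra hc
    rcases eq_or_lt_of_le (not_lt.1 hc) with h1 | h1
    · subst h1; omega
    · have := hx y h1; omega

theorem count_chain (U : ℤ → Prop) [DecidablePred U] (F : ℤ → ℤ) (w q : ℤ) (hq : U q)
    (h : ∀ x, U x → x < q → ∃ x', x < x' ∧ x' ≤ q ∧ U x' ∧ F x' = F x + w ∧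
      ∀ y, x < y → y < x' → ¬ U y) (k : ℕ) : ∀ p, U p → p ≤ q → q - p ≤ k →
      w * (((Finset.Icc p q).filter U).card : ℤ) = F q - F p + w := by
  induction k with
  | zero =>
    intro p hp h1 h2
    have : p = q := by push_cast at h2; omega
    subst this
    have : (Finset.Icc p p).filter U = {p} := by
      ext y; simp only [Finset.mem_filter, Finset.mem_Icc, Finset.mem_singleton]
      constructor
      · intro hy; omega
      · rintro rfl; exact ⟨by omega, hp⟩
    rw [this]; simp
  | succ k ih =>
    intro p hp h1 h2
    rcases eq_or_lt_of_le h1 with h3 | h3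
    · subst h3; exact ih p hp le_rfl (by omega)
    obtain ⟨x', h4, h5, h6, h7, h8⟩ := h p hp h3
    have h9 := ih x' h6 h5 (by push_cast at h2; omega)
    have : (Finset.Icc p q).filter U = insert p ((Finset.Icc x' q).filter U) := by
      ext y; simp only [Finset.mem_filter, Finset.mem_Icc, Finset.mem_insert]
      constructor
      · rintro ⟨hy1, hy2⟩
        by_cases hyp : y = p
        · exact Or.inl hyp
        · refine Or.inr ⟨⟨?_, hy1.2⟩, hy2⟩
          by_contra hc
          exact h8 y (by omega) (by omega) hy2
      · rintro (rfl | ⟨hy1, hy2⟩)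
        · exact ⟨by omega, hp⟩
        · exact ⟨by omega, hy2⟩
    rw [this, Finset.card_insert_of_notMem (by simp; intro; omega)]
    push_cast
    linarith

/-- records in residue class, next one -/
theorem rec_step (F : ℤ → ℤ) (n D : ℤ) (hn : 0 < n) (hD : 0 < D) (hp : ∀ x, F (x+n) = F x + D)
    (hF : ∀ x, F (x+1) ≤ F x + 1) (w r : ℤ) (hw : 0 < w) (q : ℤ) (hq : Rec F q) (hqr : w ∣ F q - r)
    (x : ℤ) (hx : Rec F x ∧ w ∣ F x - r) (hxq : x < q) :
    ∃ x', x < x' ∧ x' ≤ q ∧ (Rec F x' ∧ w ∣ F x' - r) ∧ F x' = F x + w ∧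
      ∀ y, x < y → y < x' → ¬ (Rec F y ∧ w ∣ F y - r) := by
  obtain ⟨x', h1, h2⟩ := rec_exists F n D hn hD hp hF (F x + w)
  have key : ∀ y, Rec F y → w ∣ F y - r → x < y → F x + w ≤ F y := by
    intro y hy hyr hxy
    have h3 := hy x hxy
    have h4 : w ∣ F y - F x := by
      have := dvd_sub hyr hx.2
      simpa using this
    have := Int.le_of_dvd (by omega) h4
    omega
  refine ⟨x', ?_, ?_, ⟨h2, ?_⟩, h1, ?_⟩
  · rw [rec_lt_iff F hx.1 h2]; omega
  · by_contra hc
    have h5 := h2 q (by omega)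
    have := key q hq hqr hxq
    omega
  · rw [h1, show F x + w - r = (F x - r) + w by ring]
    exact dvd_add hx.2 dvd_rfl
  · rintro y h3 h4 ⟨h5, h6⟩
    have := key y h5 h6 h3
    have := h2 y h4
    omega

theorem rec_count (F : ℤ → ℤ) (n D : ℤ) (hn : 0 < n) (hD : 0 < D) (hp : ∀ x, F (x+n) = F x + D)
    (hF : ∀ x, F (x+1) ≤ F x + 1) (w r : ℤ) (hw : 0 < w) (p q : ℤ) (hpp : Rec F p) (hpr : w ∣ F p - r)
    (hq : Rec F q) (hqr : w ∣ F q - r) (hpq : p ≤ q)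
    [DecidablePred (fun x => Rec F x ∧ w ∣ F x - r)] :
    w * (((Finset.Icc p q).filter (fun x => Rec F x ∧ w ∣ F x - r)).card : ℤ) = F q - F p + w :=
  count_chain (fun x => Rec F x ∧ w ∣ F x - r) F w q ⟨hq, hqr⟩
    (rec_step F n D hn hD hp hF w r hw q hq hqr) (q-p).toNat p ⟨hpp, hpr⟩ hpq (by omega)


def C1 (n : ℤ) (C : ℤ → ℤ → Prop) : Prop := ∀ a e, C a e → a + 2 ≤ e ∧ e ≤ a + n
def NC (C : ℤ → ℤ → Prop) : Prop := ∀ a b c e, C a b → C c e → a < c → c < b → e ≤ b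
def Nxt (C : ℤ → ℤ → Prop) (x x' : ℤ) : Prop :=
  x < x' ∧ (x' = x + 1 ∨ C x x') ∧ ∀ d, C x d → d ≤ x'
def Low (C : ℤ → ℤ → Prop) (a e x : ℤ) : Prop :=
  a < x ∧ x < e ∧ (x = a + 1 ∨ C a x) ∧ ∀ d, C a d → d < e → d ≤ x

def Inn (C : ℤ → ℤ → Prop) (a e x : ℤ) : Prop :=
  ∃ c d, C c d ∧ ¬ (c = a ∧ d = e) ∧ a ≤ c ∧ c < x ∧ x < d ∧ d ≤ e

open Classical in
noncomputable def S0 (C : ℤ → ℤ → Prop) (a e : ℤ) : Finset ℤ :=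
  (Finset.Icc a e).filter (fun x => ¬ Inn C a e x)

def FinFace (C : ℤ → ℤ → Prop) (S : Finset ℤ) : Prop :=
  3 ≤ S.card ∧
  (∀ u v : ℤ, ConsecIn S u v → v = u + 1 ∨ C u v) ∧
  (∃ a ∈ S, ∃ b ∈ S, (∀ x ∈ S, a ≤ x ∧ x ≤ b) ∧ C a b ∧
    ∀ u ∈ S, ∀ v ∈ S, u < v → C u v → (u = a ∧ v = b) ∨ ConsecIn S u v)

theorem mem_S0 {C : ℤ → ℤ → Prop} {a e x : ℤ} : x ∈ S0 C a e ↔ (a ≤ x ∧ x ≤ e) ∧ ¬ Inn C a e x := by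
  unfold S0; simp [Finset.mem_filter]

theorem nxt_exists {n : ℤ} {C : ℤ → ℤ → Prop} (h1 : C1 n C) (x : ℤ) : ∃ x', Nxt C x x' := by
  by_cases h : ∃ e, C x e
  · obtain ⟨e, he, hm⟩ := Int.exists_greatest_of_bdd (P := fun e => C x e)
      ⟨x + n, fun z hz => (h1 x z hz).2⟩ h
    exact ⟨e, by have := (h1 x e he).1; omega, Or.inr he, hm⟩
  · push Not at h
    exact ⟨x+1, by omega, Or.inl rfl, fun d hd => absurd hd (h d)⟩

theorem low_exists {n : ℤ} {C : ℤ → ℤ → Prop} (h1 : C1 n C) (a e : ℤ) (hae : C a e) :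
    ∃ x, Low C a e x := by
  by_cases h : ∃ d, C a d ∧ d < e
  · obtain ⟨x, hx, hm⟩ := Int.exists_greatest_of_bdd (P := fun d => C a d ∧ d < e)
      ⟨e, fun z hz => hz.2.le⟩ h
    exact ⟨x, by have := (h1 a x hx.1).1; omega, hx.2, Or.inr hx.1, fun d h1 h2 => hm d ⟨h1, h2⟩⟩
  · push Not at h
    have := (h1 a e hae).1
    exact ⟨a+1, by omega, by omega, Or.inl rfl, fun d hd h3 => absurd h3 (not_lt.2 (h d hd))⟩

theorem S0_left {n : ℤ} {C : ℤ → ℤ → Prop} (h1 : C1 n C) {a e : ℤ} (hae : C a e) : a ∈ S0 C a e := by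
  rw [mem_S0]
  have := (h1 a e hae).1
  refine ⟨by omega, ?_⟩
  rintro ⟨c, d, h⟩
  omega

theorem S0_right {n : ℤ} {C : ℤ → ℤ → Prop} (h1 : C1 n C) {a e : ℤ} (hae : C a e) : e ∈ S0 C a e := by
  rw [mem_S0]
  have := (h1 a e hae).1
  refine ⟨by omega, ?_⟩
  rintro ⟨c, d, h⟩
  omega

theorem S0_step {n : ℤ} {C : ℤ → ℤ → Prop} (h1 : C1 n C) (h2 : NC C) {a e x x' : ℤ} (hae : C a e)
    (hx : x ∈ S0 C a e) (hax : a < x) (hxe : x < e) (hn : Nxt C x x') :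
    x' ∈ S0 C a e ∧ ∀ y, x < y → y < x' → y ∉ S0 C a e := by
  rw [mem_S0] at hx
  obtain ⟨n1, n2, n3⟩ := hn
  have hle : x' ≤ e := by
    rcases n2 with h | h
    · omega
    · exact h2 a e x x' hae h hax hxe
  constructor
  · rw [mem_S0]
    refine ⟨by omega, ?_⟩
    rintro ⟨c, d, hcd, hne, k1, k2, k3, k4⟩
    rcases lt_trichotomy c x with h | h | h
    · exact hx.2 ⟨c, d, hcd, hne, k1, h, by omega, k4⟩
    · subst h; have := n3 d hcd; omega
    · rcases n2 with h' | h'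
      · omega
      · have := h2 x x' c d h' hcd h k2; omega
  · intro y hy1 hy2 hy
    rw [mem_S0] at hy
    rcases n2 with h' | h'
    · omega
    · exact hy.2 ⟨x, x', h', by omega, by omega, hy1, hy2, hle⟩

theorem S0_low {n : ℤ} {C : ℤ → ℤ → Prop} (h1 : C1 n C) (h2 : NC C) {a e x : ℤ} (hae : C a e)
    (hl : Low C a e x) : x ∈ S0 C a e ∧ ∀ y, a < y → y < x → y ∉ S0 C a e := by
  obtain ⟨l1, l2, l3, l4⟩ := hl
  constructor
  · rw [mem_S0]
    refine ⟨by omega, ?_⟩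
    rintro ⟨c, d, hcd, hne, k1, k2, k3, k4⟩
    rcases eq_or_lt_of_le k1 with h | h
    · subst h
      have : d < e := by
        rcases eq_or_lt_of_le k4 with h | h
        · exact absurd ⟨rfl, h⟩ hne
        · exact h
      have := l4 d hcd this; omega
    · rcases l3 with h' | h'
      · omega
      · have := h2 a x c d h' hcd h k2; omega
  · intro y hy1 hy2 hy
    rw [mem_S0] at hy
    rcases l3 with h' | h'
    · omega
    · exact hy.2 ⟨a, x, h', by omega, le_rfl, hy1, hy2, l2.le⟩

theorem S0_card {n : ℤ} {C : ℤ → ℤ → Prop} (h1 : C1 n C) (h2 : NC C) (F : ℤ → ℤ) {a e x : ℤ}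
    (hae : C a e) (hl : Low C a e x)
    (hF : ∀ y, a < y → y < e → ∀ y', Nxt C y y' → F y' = F y + 1) :
    ((S0 C a e).card : ℤ) = F e - F x + 2 := by
  classical
  obtain ⟨l5, l6⟩ := S0_low h1 h2 hae hl
  obtain ⟨l1, l2, l3, l4⟩ := hl
  have h := count_chain (fun y => a < y ∧ y ∈ S0 C a e) F 1 e ⟨by omega, S0_right h1 hae⟩ (by
    rintro y ⟨hy1, hy2⟩ hy3
    obtain ⟨y', hy'⟩ := nxt_exists h1 y
    obtain ⟨s1, s2⟩ := S0_step h1 h2 hae hy2 hy1 hy3 hy'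
    refine ⟨y', hy'.1, (mem_S0.1 s1).1.2, ⟨by have := hy'.1; omega, s1⟩, hF y hy1 hy3 y' hy', ?_⟩
    intro z hz1 hz2 hz3
    exact s2 z hz1 hz2 hz3.2) (e-x).toNat x ⟨l1, l5⟩ l2.le (by omega)
  have heq : S0 C a e = insert a ((Finset.Icc x e).filter (fun y => a < y ∧ y ∈ S0 C a e)) := by
    ext y
    simp only [Finset.mem_insert, Finset.mem_filter, Finset.mem_Icc]
    constructor
    · intro hy
      have hy' := mem_S0.1 hy
      by_cases hya : y = a
      · exact Or.inl hya
      · refine Or.inr ⟨⟨?_, hy'.1.2⟩, by omega, hy⟩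
        by_contra hc
        exact l6 y (by omega) (by omega) hy
    · rintro (rfl | hy)
      · exact S0_left h1 hae
      · exact hy.2.2
  rw [heq, Finset.card_insert_of_notMem (by simp)]
  push_cast
  linarith

theorem S0_face {n : ℤ} {C : ℤ → ℤ → Prop} (h1 : C1 n C) (h2 : NC C) {a e : ℤ}
    (hae : C a e) : FinFace C (S0 C a e) := by
  obtain ⟨x, hl⟩ := low_exists h1 a e hae
  obtain ⟨l5, l6⟩ := S0_low h1 h2 hae hl
  obtain ⟨l1, l2, l3, l4⟩ := hl
  have ha := S0_left h1 hae
  have he := S0_right h1 hae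
  refine ⟨?_, ?_, a, ha, e, he, fun y hy => (mem_S0.1 hy).1, hae, ?_⟩
  · have hsub : ({a, x, e} : Finset ℤ) ⊆ S0 C a e := by
      intro y hy
      simp only [Finset.mem_insert, Finset.mem_singleton] at hy
      rcases hy with rfl | rfl | rfl <;> assumption
    have := Finset.card_le_card hsub
    rw [Finset.card_insert_of_notMem (by simp; omega), Finset.card_insert_of_notMem (by simp; omega)]
      at this
    simpa using this
  · rintro u v ⟨hu, hv, huv, hc⟩
    have hu' := (mem_S0.1 hu).1
    have hv' := (mem_S0.1 hv).1
    rcases eq_or_lt_of_le hu'.1 with h | h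
    · subst h
      have : v = x := by
        rcases lt_trichotomy v x with h | h | h
        · exact absurd hv (l6 v huv h)
        · exact h
        · exact absurd ⟨l1, h⟩ (hc x l5)
      subst this; exact l3
    · obtain ⟨x', hx'⟩ := nxt_exists h1 u
      obtain ⟨s1, s2⟩ := S0_step h1 h2 hae hu h (by omega) hx'
      have : v = x' := by
        rcases lt_trichotomy v x' with h | h | h
        · exact absurd hv (s2 v huv h)
        · exact h
        · exact absurd ⟨hx'.1, h⟩ (hc x' s1)
      subst this; exact hx'.2.1
  · intro u hu v hv huv hC
    by_cases h : u = a ∧ v = e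
    · exact Or.inl h
    · refine Or.inr ⟨hu, hv, huv, ?_⟩
      rintro y hy ⟨hy1, hy2⟩
      exact (mem_S0.1 hy).2 ⟨u, v, hC, h, (mem_S0.1 hu).1.1, hy1, hy2, (mem_S0.1 hv).1.2⟩

theorem consec_around (S : Finset ℤ) (a e x : ℤ) (ha : a ∈ S) (he : e ∈ S) (hax : a < x) (hxe : x < e)
    (hx : x ∉ S) : ∃ u v, ConsecIn S u v ∧ u < x ∧ x < v := by
  obtain ⟨u, ⟨hu1, hu2⟩, hu3⟩ := Int.exists_greatest_of_bdd (P := fun z => z ∈ S ∧ z < x)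
    ⟨x, fun z hz => hz.2.le⟩ ⟨a, ha, hax⟩
  obtain ⟨v, ⟨hv1, hv2⟩, hv3⟩ := Int.exists_least_of_bdd (P := fun z => z ∈ S ∧ x < z)
    ⟨x, fun z hz => hz.2.le⟩ ⟨e, he, hxe⟩
  refine ⟨u, v, ⟨hu1, hv1, by omega, ?_⟩, hu2, hv2⟩
  rintro y hy ⟨h1, h2⟩
  rcases lt_trichotomy y x with h | h | h
  · have := hu3 y ⟨hy, h⟩; omega
  · subst h; exact hx hy
  · have := hv3 y ⟨hy, h⟩; omega

theorem face_S0 {C : ℤ → ℤ → Prop} (h2 : NC C) {S : Finset ℤ}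
    (hS : FinFace C S) : ∃ a e, C a e ∧ S = S0 C a e := by
  obtain ⟨hc, hedge, a, ha, e, he, hb, hae, hch⟩ := hS
  refine ⟨a, e, hae, ?_⟩
  ext x
  constructor
  · intro hx
    rw [mem_S0]
    refine ⟨hb x hx, ?_⟩
    rintro ⟨c, d, hcd, hne, k1, k2, k3, k4⟩
    have hcS : c ∈ S := by
      by_contra hcS
      rcases eq_or_lt_of_le k1 with h | h
      · subst h; exact hcS ha
      obtain ⟨u, v, hcon, hu, hv⟩ := consec_around S a e c ha he h (by omega) hcS
      rcases hedge u v hcon with h' | h'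
      · omega
      · have := h2 u v c d h' hcd hu hv
        exact hcon.2.2.2 x hx (by omega)
    have hdS : d ∈ S := by
      by_contra hdS
      rcases eq_or_lt_of_le k4 with h | h
      · subst h; exact hdS he
      obtain ⟨u, v, hcon, hu, hv⟩ := consec_around S a e d ha he (by omega) h hdS
      rcases hedge u v hcon with h' | h'
      · omega
      · rcases lt_or_ge c u with h3 | h3
        · have := h2 c d u v hcd h' h3 hu; omega
        · exact hcon.2.2.2 x hx (by omega)
    rcases hch c hcS d hdS (by omega) hcd with h | h
    · exact hne h
    · exact h.2.2.2 x hx ⟨k2, k3⟩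
  · intro hx
    by_contra hxS
    obtain ⟨hx1, hx2⟩ := mem_S0.1 hx
    have hax : a < x := lt_of_le_of_ne hx1.1 (by rintro rfl; exact hxS ha)
    have hxe : x < e := lt_of_le_of_ne hx1.2 (by rintro rfl; exact hxS he)
    obtain ⟨u, v, hcon, hu, hv⟩ := consec_around S a e x ha he hax hxe hxS
    have hu' := hb u hcon.1
    have hv' := hb v hcon.2.1
    rcases hedge u v hcon with h' | h'
    · omega
    · by_cases h : u = a ∧ v = e
      · obtain ⟨rfl, rfl⟩ := h
        have : S ⊆ {u, v} := by
          intro y hy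
          have := hcon.2.2.2 y hy
          have := hb y hy
          simp only [Finset.mem_insert, Finset.mem_singleton]
          omega
        have := (Finset.card_le_card this).trans Finset.card_le_two
        omega
      · exact hx2 ⟨u, v, h', h, hu'.1, hu, hv, hv'.2⟩

end AbsPart


section RulePart
open Finset

def CR (F : ℤ → ℤ) (m : ℕ) (a e : ℤ) : Prop :=
  a + 1 < e ∧ F e ≤ F a + 1 ∧ (m : ℤ) ∣ F e - F a - 1 ∧ ∀ y, a < y → y < e → F y < F e

structure Good (F : ℤ → ℤ) (f : ℤ → ℕ) (m : ℕ) (n D : ℤ) : Prop where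
  hm : 0 < m
  hn : 0 < n
  hD : 0 < D
  hp : ∀ x, F (x + n) = F x + D
  hs : ∀ x, F (x + 1) = F x + 1 - m * f x

open Classical in
noncomputable def cnt (C : ℤ → ℤ → Prop) (n a : ℤ) : ℕ := ((Finset.Icc a (a+n)).filter (fun e => C a e)).card

open Classical in
noncomputable def cntle (C : ℤ → ℤ → Prop) (n a e : ℤ) : ℕ :=
  ((Finset.Icc a (a+n)).filter (fun e' => C a e' ∧ e' ≤ e)).card

variable {F : ℤ → ℤ} {f : ℤ → ℕ} {m : ℕ} {n D : ℤ}

theorem Good.skip (g : Good F f m n D) (x : ℤ) : F (x+1) ≤ F x + 1 := by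
  rw [g.hs]
  have : (0 : ℤ) ≤ m * f x := by positivity
  linarith

theorem dvd_lt_le {m : ℕ} {a b : ℤ} (h : (m : ℤ) ∣ a - b) (hlt : a < b) : a + m ≤ b := by
  have h2 : (m : ℤ) ∣ b - a := by rw [← neg_sub]; exact (dvd_neg).2 h
  have := Int.le_of_dvd (by omega) h2
  omega

theorem CR_C1 (g : Good F f m n D) : C1 n (CR F m) := by
  rintro a e ⟨h1, h2, h3, h4⟩
  refine ⟨by omega, ?_⟩
  by_contra hc
  have h5 := h4 (a+n) (by have := g.hn; omega) (by omega)
  have := g.hD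
  rw [g.hp] at h5
  omega

theorem CR_NC : NC (CR F m) := by
  rintro a b c e ⟨h1, h2, h3, h4⟩ ⟨k1, k2, k3, k4⟩ hac hcb
  by_contra hc
  have := k4 b hcb (by omega)
  have := h4 c hac hcb
  omega

theorem CR_gt {a e : ℤ} (h : CR F m a e) : F (a+1) < F e := h.2.2.2 (a+1) (by omega) h.1

theorem Good.hit (g : Good F f m n D) (a L : ℤ) (h : F (a+1) ≤ L) :
    ∃ e, a < e ∧ F e = L ∧ ∀ y, a < y → y < e → F y < L :=
  first_hit F g.skip a L h (F_unbdd F n D g.hn g.hD g.hp a L)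

theorem CR_nxt (g : Good F f m n D) {x x' : ℤ} (h : Nxt (CR F m) x x') : F x' = F x + 1 := by
  obtain ⟨h1, h2, h3⟩ := h
  obtain ⟨e, e1, e2, e3⟩ := g.hit x (F x + 1) (g.skip x)
  by_cases he : e = x + 1
  · subst he
    rcases h2 with h2 | h2
    · rw [h2, e2]
    · have := CR_gt h2
      have := h2.2.1
      omega
  · have hC : CR F m x e := ⟨by omega, by omega, by rw [e2]; simp, fun y hy1 hy2 => by
      rw [e2]; exact e3 y hy1 hy2⟩
    have h4 := h3 e hC
    rcases h2 with h2 | h2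
    · omega
    · rcases eq_or_lt_of_le h4 with h5 | h5
      · rw [← h5, e2]
      · have := h2.2.2.2 e e1 h5
        have := h2.2.1
        omega

theorem CR_cong {a e e' : ℤ} (h : CR F m a e) (h' : CR F m a e') : (m : ℤ) ∣ F e - F e' := by
  have := dvd_sub h.2.2.1 h'.2.2.1
  rwa [show F e - F a - 1 - (F e' - F a - 1) = F e - F e' by ring] at this

theorem CR_congl (g : Good F f m n D) {a e : ℤ} (h : CR F m a e) : (m : ℤ) ∣ F (a+1) - F e := by
  have h1 := h.2.2.1
  have h2 : F (a+1) - F e = -(F e - F a - 1) - m * f a := by rw [g.hs]; ring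
  rw [h2]
  exact dvd_sub ((dvd_neg).2 h1) (dvd_mul_right _ _)

theorem CR_low (g : Good F f m n D) {a e x : ℤ} (hae : CR F m a e) (h : Low (CR F m) a e x) :
    F x = F e - m := by
  obtain ⟨l1, l2, l3, l4⟩ := h
  have hm := g.hm
  have k1 := dvd_lt_le (CR_congl g hae) (CR_gt hae)
  obtain ⟨t, t1, t2, t3⟩ := g.hit a (F e - m) (by omega)
  have hte : t < e := by
    rcases lt_trichotomy t e with h | h | h
    · exact h
    · subst h; omega
    · have := t3 e (by have := hae.1; omega) h; omega
  have key : CR F m a x → F x ≤ F e - m := by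
    intro hx
    have h1 := hae.2.2.2 x l1 l2
    have := dvd_lt_le (CR_cong hx hae) h1
    omega
  by_cases ht : t = a + 1
  · subst ht
    rcases l3 with l3 | l3
    · rw [l3, t2]
    · have := key l3
      have := CR_gt l3
      omega
  · have hC : CR F m a t := by
      refine ⟨by omega, by have := hae.2.1; omega, ?_, fun y hy1 hy2 => by rw [t2]; exact t3 y hy1 hy2⟩
      rw [t2, show F e - m - F a - 1 = (F e - F a - 1) - m by ring]
      exact dvd_sub hae.2.2.1 dvd_rfl
    have h4 := l4 t hC hte
    rcases l3 with l3 | l3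
    · omega
    · have := key l3
      rcases eq_or_lt_of_le h4 with h5 | h5
      · rw [← h5, t2]
      · have := l3.2.2.2 t t1 h5
        omega

theorem CR_face (g : Good F f m n D) {a e : ℤ} (hae : CR F m a e) : (S0 (CR F m) a e).card = m + 2 := by
  obtain ⟨x, hx⟩ := low_exists (CR_C1 g) a e hae
  have h := S0_card (CR_C1 g) CR_NC F hae hx (fun y _ _ y' hy' => CR_nxt g hy')
  rw [CR_low g hae hx] at h
  have : (((S0 (CR F m) a e).card : ℕ) : ℤ) = ((m + 2 : ℕ) : ℤ) := by rw [h]; push_cast; ring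
  exact_mod_cast this

theorem CR_covered (g : Good F f m n D) (x : ℤ) :
    (∃ a b, CR F m a b ∧ a < x ∧ x < b) ↔ ¬ Rec F x := by
  constructor
  · rintro ⟨a, b, h, h1, h2⟩ hr
    have := hr a h1
    have := h.2.2.2 x h1 h2
    have := h.2.1
    omega
  · intro hr
    unfold Rec at hr
    push Not at hr
    obtain ⟨y0, hy0⟩ := hr
    obtain ⟨y, ⟨hy1, hy2⟩, hy3⟩ := Int.exists_greatest_of_bdd (P := fun y => y < x ∧ F x ≤ F y)
      ⟨x, fun z hz => hz.1.le⟩ ⟨y0, hy0⟩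
    obtain ⟨e, e1, e2, e3⟩ := g.hit y (F y + 1) (g.skip y)
    have hxe : x < e := by
      by_contra hc
      rcases eq_or_lt_of_le (not_lt.1 hc) with h | h
      · subst h; omega
      · have := hy3 e ⟨h, by omega⟩; omega
    exact ⟨y, e, ⟨by omega, by omega, by rw [e2]; simp, fun z h1 h2 => by rw [e2]; exact e3 z h1 h2⟩,
      hy1, hxe⟩

theorem cnt_CR (g : Good F f m n D) (a : ℤ) : cnt (CR F m) n a = f a := by
  classical
  have hm : (0 : ℤ) < m := by exact_mod_cast g.hm
  unfold cnt
  have hinj1 : Set.InjOn F ((Finset.Icc a (a+n)).filter (fun e => CR F m a e) : Finset ℤ) := by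
    intro e he e' he' hee
    simp only [Finset.coe_filter, Set.mem_setOf_eq] at he he'
    by_contra hne
    rcases lt_or_gt_of_ne hne with h | h
    · have := he'.2.2.2.2 e (by have := he.2.1; omega) h; omega
    · have := he.2.2.2.2 e' (by have := he'.2.1; omega) h; omega
  have hinj2 : Function.Injective (fun i : ℕ => F a + 1 - m * (i : ℤ)) := by
    intro i j hij
    have h1 : (m : ℤ) * i = m * j := by simp only at hij; linarith
    exact_mod_cast mul_left_cancel₀ hm.ne' h1
  have himg : ((Finset.Icc a (a+n)).filter (fun e => CR F m a e)).image F =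
      (Finset.range (f a)).image (fun i : ℕ => F a + 1 - m * (i : ℤ)) := by
    ext L
    simp only [Finset.mem_image, Finset.mem_filter, Finset.mem_range]
    constructor
    · rintro ⟨e, ⟨_, he⟩, rfl⟩
      obtain ⟨t, ht⟩ := he.2.2.1
      have h1 := CR_gt he
      have h2 := he.2.1
      rw [g.hs] at h1
      have h3 : t ≤ 0 := by by_contra hc; push Not at hc; nlinarith
      refine ⟨(-t).toNat, ?_, ?_⟩
      · have : -t < f a := by
          by_contra hc; push Not at hc; nlinarith
        omega
      · rw [Int.toNat_of_nonneg (by omega)]; linarith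
    · rintro ⟨i, hi, rfl⟩
      have hlt : F (a+1) < F a + 1 - m * (i:ℤ) := by
        rw [g.hs]
        have : (i : ℤ) < f a := by exact_mod_cast hi
        nlinarith
      obtain ⟨e, e1, e2, e3⟩ := g.hit a _ hlt.le
      have hC : CR F m a e := by
        refine ⟨?_, ?_, ?_, fun y h1 h2 => by rw [e2]; exact e3 y h1 h2⟩
        · rcases eq_or_lt_of_le (show a + 1 ≤ e by omega) with h | h
          · subst h; omega
          · exact h
        · rw [e2]; nlinarith
        · exact ⟨-i, by rw [e2]; ring⟩
      have := CR_C1 g a e hC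
      exact ⟨e, ⟨by simp; omega, hC⟩, e2⟩
  have h := congrArg Finset.card himg
  rw [Finset.card_image_of_injOn hinj1, Finset.card_image_of_injective _ hinj2, Finset.card_range] at h
  exact h


def PA (C : ℤ → ℤ → Prop) (F : ℤ → ℤ) (m : ℕ) (n a e : ℤ) : Prop :=
  F e = F (a+1) + m * cntle C n a e ∧ ∀ y, a < y → y < e → F y < F e

theorem PA_nxt {C : ℤ → ℤ → Prop} (h1 : C1 n C) (hs : ∀ x, F (x+1) = F x + 1 - m * cnt C n x)
    {x x' : ℤ} (hP : ∀ e, C x e → PA C F m n x e) (hx : Nxt C x x') : F x' = F x + 1 := by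
  obtain ⟨k1, k2, k3⟩ := hx
  rcases k2 with k2 | k2
  · subst k2
    have : cnt C n x = 0 := by
      classical
      unfold cnt
      rw [Finset.card_eq_zero, Finset.filter_eq_empty_iff]
      intro d _ hd
      have := k3 d hd
      have := (h1 x d hd).1
      omega
    rw [hs, this]; simp
  · have h := (hP x' k2).1
    have : cntle C n x x' = cnt C n x := by
      classical
      unfold cnt cntle
      congr 1
      ext d
      simp only [Finset.mem_filter]
      constructor
      · rintro ⟨a, b, c⟩; exact ⟨a, b⟩
      · rintro ⟨a, b⟩; exact ⟨a, b, k3 d b⟩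
    rw [h, this, hs]; ring

theorem PA_all {C : ℤ → ℤ → Prop} (h1 : C1 n C) (h2 : NC C)
    (hs : ∀ x, F (x+1) = F x + 1 - m * cnt C n x)
    (hface : ∀ a e, C a e → (S0 C a e).card = m + 2) (k : ℕ) :
    ∀ a e, C a e → e - a ≤ k → PA C F m n a e := by
  induction k with
  | zero => intro a e hae h; have := (h1 a e hae).1; push_cast at h; omega
  | succ k ih =>
    intro a e hae hk
    push_cast at hk
    have hnx : ∀ y, a < y → y < e → ∀ y', Nxt C y y' → F y' = F y + 1 := by
      intro y hy1 hy2 y' hy'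
      refine PA_nxt h1 hs (fun d hd => ih y d hd ?_) hy'
      have := h2 a e y d hae hd hy1 hy2
      omega
    obtain ⟨x, hx⟩ := low_exists h1 a e hae
    have hcard := S0_card h1 h2 F hae hx hnx
    rw [hface a e hae] at hcard
    push_cast at hcard
    obtain ⟨l1, l2, l3, l4⟩ := hx
    have hcl : cntle C n a e = cntle C n a x + 1 := by
      classical
      unfold cntle
      have : (Finset.Icc a (a+n)).filter (fun e' => C a e' ∧ e' ≤ e) =
          insert e ((Finset.Icc a (a+n)).filter (fun e' => C a e' ∧ e' ≤ x)) := by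
        ext d
        simp only [Finset.mem_filter, Finset.mem_insert, Finset.mem_Icc]
        constructor
        · rintro ⟨ha, hb, hc⟩
          rcases eq_or_lt_of_le hc with h | h
          · exact Or.inl h
          · exact Or.inr ⟨ha, hb, l4 d hb h⟩
        · rintro (rfl | ⟨ha, hb, hc⟩)
          · have := h1 a d hae
            exact ⟨by omega, hae, le_rfl⟩
          · exact ⟨ha, hb, by omega⟩
      rw [this, Finset.card_insert_of_notMem]
      simp only [Finset.mem_filter]
      rintro ⟨_, _, h⟩
      omega
    have hFx : F x = F (a+1) + m * cntle C n a x := by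
      rcases l3 with l3 | l3
      · have : cntle C n a x = 0 := by
          classical
          unfold cntle
          rw [Finset.card_eq_zero, Finset.filter_eq_empty_iff]
          rintro d _ ⟨hd, hd2⟩
          have := (h1 a d hd).1
          omega
        rw [this, l3]; simp
      · exact (ih a x l3 (by omega)).1
    refine ⟨?_, ?_⟩
    · rw [hcl]; push_cast; linarith
    · have : ∀ j : ℕ, ∀ y, a < y → y < e → e - y ≤ j → F y < F e := by
        intro j
        induction j with
        | zero => intro y _ h3 h4; push_cast at h4; omega
        | succ j ihj =>
          intro y hy1 hy2 hy3
          push_cast at hy3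
          obtain ⟨y', hy'⟩ := nxt_exists h1 y
          have hF := hnx y hy1 hy2 y' hy'
          have hle : y' ≤ e := by
            rcases hy'.2.1 with h | h
            · omega
            · exact h2 a e y y' hae h hy1 hy2
          have := hy'.1
          rcases eq_or_lt_of_le hle with h | h
          · subst h; omega
          · have := ihj y' (by omega) h (by omega)
            omega
      intro y hy1 hy2
      exact this (e-y).toNat y hy1 hy2 (by omega)

theorem PA_CR {C : ℤ → ℤ → Prop} (h1 : C1 n C) 
    (g : Good F (cnt C n) m n D) (hPA : ∀ a e, C a e → PA C F m n a e) (a e : ℤ) :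
    C a e ↔ CR F m a e := by
  classical
  have hm : (0 : ℤ) < m := by exact_mod_cast g.hm
  have himp : ∀ e, C a e → CR F m a e := by
    intro e he
    obtain ⟨p1, p2⟩ := hPA a e he
    have hle : (cntle C n a e : ℤ) ≤ cnt C n a := by
      have : cntle C n a e ≤ cnt C n a := by
        unfold cnt cntle
        apply Finset.card_le_card
        intro d
        simp only [Finset.mem_filter]
        rintro ⟨a, b, c⟩; exact ⟨a, b⟩
      exact_mod_cast this
    have hs := g.hs a
    refine ⟨by have := (h1 a e he).1; omega, ?_, ?_, p2⟩
    · rw [p1, hs]; nlinarith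
    · exact ⟨cntle C n a e - cnt C n a, by rw [p1, hs]; ring⟩
  refine ⟨himp e, fun he => ?_⟩
  have hsub : (Finset.Icc a (a+n)).filter (fun e => C a e) ⊆
      (Finset.Icc a (a+n)).filter (fun e => CR F m a e) := by
    intro d
    simp only [Finset.mem_filter]
    rintro ⟨h, h'⟩; exact ⟨h, himp d h'⟩
  have hc := cnt_CR g a
  have heq := Finset.eq_of_subset_of_card_le hsub (by
    unfold cnt at hc; convert hc.le)
  have hmem : e ∈ (Finset.Icc a (a+n)).filter (fun e => CR F m a e) := by
    have := CR_C1 g a e he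
    simp only [Finset.mem_filter, Finset.mem_Icc]
    exact ⟨by omega, he⟩
  rw [← heq] at hmem
  exact (Finset.mem_filter.1 hmem).2

end RulePart


section ArcPart
open Finset

def cls (n : ℕ) (hn : 0 < n) (a : ℤ) : Fin n :=
  ⟨(a % n).toNat, by
    have h1 := Int.emod_nonneg a (b := (n:ℤ)) (by omega)
    have h2 := Int.emod_lt_of_pos a (b := (n:ℤ)) (by omega)
    omega⟩

theorem cls_val {n : ℕ} (hn : 0 < n) (a : ℤ) : ((cls n hn a).val : ℤ) = a % n := by
  have h1 := Int.emod_nonneg a (b := (n:ℤ)) (by omega)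
  simp [cls, h1]

theorem cls_eq {n : ℕ} (hn : 0 < n) (a b : ℤ) : cls n hn a = cls n hn b ↔ a % n = b % n := by
  rw [← cls_val hn, ← cls_val hn, Fin.ext_iff]; omega

theorem cls_eq_dvd {n : ℕ} (hn : 0 < n) (a b : ℤ) : cls n hn a = cls n hn b ↔ (n : ℤ) ∣ b - a := by
  rw [cls_eq]; exact Int.emod_eq_emod_iff_emod_sub_eq_zero.trans
    ⟨fun h => by rw [← neg_sub]; exact (dvd_neg).2 (Int.dvd_of_emod_eq_zero h),
     fun h => Int.emod_eq_zero_of_dvd (by rw [← neg_sub]; exact (dvd_neg).2 h)⟩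

theorem cls_fin {n : ℕ} (hn : 0 < n) (i : Fin n) : cls n hn (i.val : ℤ) = i := by
  apply Fin.ext
  have h := cls_val hn (i.val : ℤ)
  have := i.isLt
  rw [Int.emod_eq_of_lt (by omega) (by omega)] at h
  omega

theorem cls_add_mul {n : ℕ} (hn : 0 < n) (a t : ℤ) : cls n hn (a + t * n) = cls n hn a := by
  rw [cls_eq]; simp

theorem gp_cast {n : ℕ} (hn : 0 < n) (a b : ℤ) :
    ((((cls n hn b).val + n - (cls n hn a).val) % n : ℕ) : ℤ) = (b - a) % n := by
  have h1 := (cls n hn a).isLt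
  rw [Int.natCast_mod, Nat.cast_sub (by omega)]
  push_cast
  rw [cls_val, cls_val, show b % (n:ℤ) + n - a % n = (b % n - a % n) + n by ring, Int.add_emod_right,
    ← Int.sub_emod]

theorem gp_cls {n : ℕ} (hn : 0 < n) (a b : ℤ) (h1 : 0 ≤ b - a) (h2 : b - a < n) :
    (PArc.gp n (cls n hn a) (cls n hn b) : ℤ) = b - a := by
  unfold PArc.gp
  rw [gp_cast, Int.emod_eq_of_lt h1 h2]

theorem len_cls {n : ℕ} (hn : 0 < n) (a b : ℤ) (h1 : 0 < b - a) (h2 : b - a ≤ n) :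
    (PArc.len n (cls n hn a) (cls n hn b) : ℤ) = b - a := by
  unfold PArc.len
  split_ifs with h
  · rw [cls_eq_dvd] at h
    have := Int.le_of_dvd h1 h
    omega
  · rw [gp_cast, Int.emod_eq_of_lt h1.le]
    rcases eq_or_lt_of_le h2 with h3 | h3
    · exact absurd ((cls_eq_dvd hn a b).2 (by rw [h3])) h
    · exact h3

theorem len_pos {n : ℕ} (hn : 0 < n) (i j : Fin n) : 0 < PArc.len n i j ∧ PArc.len n i j ≤ n := by
  unfold PArc.len
  split_ifs with h
  · omega
  · have := Nat.mod_lt (j.val + n - i.val) hn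
    refine ⟨?_, this.le⟩
    by_contra hc
    have h0 : (j.val + n - i.val) % n = 0 := by omega
    have h1 := gp_cast hn (i.val : ℤ) (j.val : ℤ)
    rw [cls_fin, cls_fin, h0] at h1
    apply h
    rw [← cls_fin hn i, ← cls_fin hn j, cls_eq_dvd]
    exact Int.dvd_of_emod_eq_zero h1.symm

theorem cls_len {n : ℕ} (hn : 0 < n) (i j : Fin n) : cls n hn ((i.val : ℤ) + PArc.len n i j) = j := by
  conv_rhs => rw [← cls_fin hn j]
  unfold PArc.len
  split_ifs with h
  · subst h; simpa using cls_add_mul hn (i.val : ℤ) 1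
  · have h1 := gp_cast hn (i.val : ℤ) (j.val : ℤ)
    rw [cls_fin, cls_fin] at h1
    rw [h1, cls_eq]
    simp

theorem isRay_iff {n : ℕ} (hn : 0 < n) (T : Finset (PArc n)) (a : ℤ) :
    IsRay T a ↔ PArc.spoke (cls n hn a) ∈ T := by
  constructor
  · rintro ⟨s, hs, t, rfl⟩
    rw [cls_add_mul, cls_fin]; exact hs
  · intro h
    refine ⟨_, h, a / n, ?_⟩
    rw [cls_val]
    have := Int.emod_add_mul_ediv a n
    linarith

theorem isChord_iff {n : ℕ} (hn : 0 < n) (T : Finset (PArc n)) (a b : ℤ) :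
    IsChord T a b ↔ PArc.per (cls n hn a) (cls n hn b) ∈ T ∧ 0 < b - a ∧ b - a ≤ n := by
  constructor
  · rintro ⟨i, j, hs, t, rfl, rfl⟩
    have := len_pos hn i j
    rw [show (i.val : ℤ) + t * n + PArc.len n i j = (i.val : ℤ) + PArc.len n i j + t * n by ring,
      cls_add_mul, cls_add_mul, cls_fin, cls_len]
    exact ⟨hs, by omega, by omega⟩
  · rintro ⟨h, h1, h2⟩
    refine ⟨_, _, h, a / n, ?_, ?_⟩
    · rw [cls_val]
      have := Int.emod_add_mul_ediv a n
      linarith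
    · rw [len_cls hn a b h1 h2]; ring

theorem per_mem_iff {n : ℕ} (hn : 0 < n) (T : Finset (PArc n)) (i j : Fin n) :
    PArc.per i j ∈ T ↔ IsChord T (i.val : ℤ) ((i.val : ℤ) + PArc.len n i j) := by
  have := len_pos hn i j
  rw [isChord_iff hn, cls_fin, cls_len]
  constructor
  · intro h; exact ⟨h, by omega, by omega⟩
  · exact fun h => h.1

theorem spoke_mem_iff {n : ℕ} (hn : 0 < n) (T : Finset (PArc n)) (i : Fin n) :
    PArc.spoke i ∈ T ↔ IsRay T (i.val : ℤ) := by
  rw [isRay_iff hn, cls_fin]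

theorem arcs_ext {n : ℕ} (hn : 0 < n) (T T' : Finset (PArc n))
    (h1 : ∀ a b, IsChord T a b ↔ IsChord T' a b) (h2 : ∀ a, IsRay T a ↔ IsRay T' a) : T = T' := by
  ext x
  cases x with
  | spoke i => rw [spoke_mem_iff hn, spoke_mem_iff hn, h2]
  | per i j => rw [per_mem_iff hn, per_mem_iff hn, h1]

theorem isRay_per {n : ℕ} (hn : 0 < n) (T : Finset (PArc n)) (a : ℤ) :
    IsRay T (a + n) ↔ IsRay T a := by
  rw [isRay_iff hn, isRay_iff hn]
  have := cls_add_mul hn a 1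
  rw [one_mul] at this
  rw [this]

theorem isChord_per {n : ℕ} (hn : 0 < n) (T : Finset (PArc n)) (a b : ℤ) :
    IsChord T (a + n) (b + n) ↔ IsChord T a b := by
  rw [isChord_iff hn, isChord_iff hn]
  have h1 := cls_add_mul hn a 1
  have h2 := cls_add_mul hn b 1
  rw [one_mul] at h1 h2
  rw [h1, h2, show b + (n:ℤ) - (a + n) = b - a by ring]

theorem spokeCount_eq {n : ℕ} (hn : 0 < n) (T : Finset (PArc n)) (a : ℤ) [DecidablePred (IsRay T)] :
    spokeCount T = ((Finset.Ico a (a+n)).filter (IsRay T)).card := by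
  unfold spokeCount
  symm
  refine Finset.card_bij (fun x _ => PArc.spoke (cls n hn x)) ?_ ?_ ?_
  · intro x hx
    simp only [Finset.mem_filter] at hx ⊢
    exact ⟨(isRay_iff hn T x).1 hx.2, rfl⟩
  · intro x hx y hy hxy
    simp only [Finset.mem_filter, Finset.mem_Ico] at hx hy
    simp only [PArc.spoke.injEq] at hxy
    rw [cls_eq_dvd] at hxy
    have := Int.eq_zero_of_abs_lt_dvd hxy (by rw [abs_lt]; omega)
    omega
  · intro x hx
    simp only [Finset.mem_filter] at hx
    cases x with
    | per i j => simp [PArc.isSpoke] at hx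
    | spoke i =>
      have h1 := Int.emod_nonneg ((i.val : ℤ) - a) (b := (n:ℤ)) (by omega)
      have h2 := Int.emod_lt_of_pos ((i.val : ℤ) - a) (b := (n:ℤ)) (by omega)
      have h3 : cls n hn (a + ((i.val : ℤ) - a) % n) = i := by
        conv_rhs => rw [← cls_fin hn i]
        rw [cls_eq]; simp
      refine ⟨a + ((i.val : ℤ) - a) % n, ?_, by rw [h3]⟩
      simp only [Finset.mem_filter, Finset.mem_Ico]
      exact ⟨by omega, by rw [isRay_iff hn, h3]; exact hx.1⟩

theorem T_C1 {n m : ℕ} (hn : 0 < n) {T : Finset (PArc n)} (hT : IsAngulation n m T) :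
    C1 n (IsChord T) := by
  rintro a e ⟨i, j, hs, t, rfl, rfl⟩
  have h1 : 2 ≤ PArc.len n i j := hT.1 _ hs
  have := len_pos hn i j
  omega

theorem T_NC {n m : ℕ} (hn : 0 < n) {T : Finset (PArc n)} (hT : IsAngulation n m T) :
    NC (IsChord T) := by
  intro a b c e h1 h2 hac hcb
  by_contra hc
  rw [isChord_iff hn] at h1 h2
  refine hT.2.1 _ h1.1 _ h2.1 ?_ ?_
  · intro heq
    simp only [PArc.per.injEq] at heq
    have h3 := heq.1
    rw [cls_eq_dvd] at h3
    have := Int.le_of_dvd (by omega) h3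
    omega
  · left
    have g1 := gp_cls hn a c (by omega) (by omega)
    have g2 := len_cls hn a b h1.2.1 h1.2.2
    have g3 := len_cls hn c e h2.2.1 h2.2.2
    refine ⟨by omega, by omega, by omega⟩

theorem T_ray {n m : ℕ} (hn : 0 < n) {T : Finset (PArc n)} (hT : IsAngulation n m T) (x : ℤ)
    (hx : IsRay T x) : ¬ Covered T x := by
  rintro ⟨a, b, h1, hax, hxb⟩
  rw [isChord_iff hn] at h1
  rw [isRay_iff hn] at hx
  refine hT.2.1 _ hx _ h1.1 (by simp) ?_
  have g1 := gp_cls hn a x (by omega) (by omega)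
  have g2 := len_cls hn a b h1.2.1 h1.2.2
  exact ⟨by omega, by omega⟩

theorem cnt_per {C : ℤ → ℤ → Prop} {n p : ℤ} (h : ∀ a b, C (a+p) (b+p) ↔ C a b) (a : ℤ) :
    cnt C n (a+p) = cnt C n a := by
  classical
  unfold cnt
  symm
  refine Finset.card_bij (fun x _ => x + p) ?_ ?_ ?_
  · intro x hx
    simp only [Finset.mem_filter, Finset.mem_Icc] at hx ⊢
    exact ⟨by omega, (h a x).2 hx.2⟩
  · intro x _ y _ hxy; simpa using hxy
  · intro y hy
    simp only [Finset.mem_filter, Finset.mem_Icc] at hy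
    refine ⟨y - p, ?_, by ring⟩
    simp only [Finset.mem_filter, Finset.mem_Icc]
    refine ⟨by omega, ?_⟩
    rw [← h, sub_add_cancel]; exact hy.2

theorem card_uncov {n : ℕ} (T : Finset (PArc n)) (a b : ℤ) [DecidablePred (fun x => ¬ Covered T x)] :
    Nat.card {x : ℤ // a ≤ x ∧ x ≤ b ∧ ¬ Covered T x} =
      ((Finset.Icc a b).filter (fun x => ¬ Covered T x)).card :=
  Nat.subtype_card _ (by intro x; simp only [Finset.mem_filter, Finset.mem_Icc]; tauto)

theorem T_struct {n m s : ℕ} (hn : 0 < n) (hm : 0 < m) (hs : 0 < s) {T : Finset (PArc n)}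
    (hT : IsAngulation n m T) (hsc : spokeCount T = s) :
    ∃ r : ℤ, Good (FF m (cnt (IsChord T) n)) (cnt (IsChord T) n) m n (m * s) ∧
      (∀ a e, IsChord T a e ↔ CR (FF m (cnt (IsChord T) n)) m a e) ∧
      (∀ x, IsRay T x ↔ Rec (FF m (cnt (IsChord T) n)) x ∧
        (m : ℤ) ∣ FF m (cnt (IsChord T) n) x - r) ∧
      (n : ℤ) - m * GG (cnt (IsChord T) n) n = m * s := by
  classical
  set f := cnt (IsChord T) n with hf
  set F := FF m f with hFdef
  have h1 := T_C1 hn hT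
  have h2 := T_NC hn hT
  have hmz : (0 : ℤ) < m := by exact_mod_cast hm
  have hFs : ∀ x, F (x+1) = F x + 1 - m * f x := FF_succ m f
  have hface : ∀ a e, IsChord T a e → (S0 (IsChord T) a e).card = m + 2 :=
    fun a e hae => hT.2.2.2.1 _ (S0_face h1 h2 hae)
  have hPA : ∀ a e, IsChord T a e → PA (IsChord T) F m n a e :=
    fun a e hae => PA_all h1 h2 hFs hface (e-a).toNat a e hae (by omega)
  have hnxt : ∀ x x', Nxt (IsChord T) x x' → F x' = F x + 1 :=
    fun x x' h => PA_nxt h1 hFs (hPA x) h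
  have hper : ∀ x, F (x + n) = F x + (n - m * GG f n) :=
    FF_add m f n (cnt_per (isChord_per hn T))
  have hunc : ∀ q, ¬ Covered T q → ∀ x, ¬ Covered T x → x < q →
      ∃ x', x < x' ∧ x' ≤ q ∧ ¬ Covered T x' ∧ F x' = F x + 1 ∧
      ∀ y, x < y → y < x' → ¬ ¬ Covered T y := by
    intro q hq x hx hxq
    obtain ⟨x', hx'⟩ := nxt_exists h1 x
    refine ⟨x', hx'.1, ?_, ?_, hnxt x x' hx', ?_⟩
    · rcases hx'.2.1 with h | h
      · omega
      · by_contra hc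
        exact hq ⟨x, x', h, hxq, by omega⟩
    · rintro ⟨c, d, hcd, k1, k2⟩
      rcases lt_trichotomy c x with h | h | h
      · exact hx ⟨c, d, hcd, h, by have := hx'.1; omega⟩
      · subst h; have := hx'.2.2 d hcd; omega
      · rcases hx'.2.1 with h' | h'
        · omega
        · have := h2 x x' c d h' hcd h k1; omega
    · intro y hy1 hy2
      push Not
      rcases hx'.2.1 with h' | h'
      · omega
      · exact ⟨x, x', h', hy1, hy2⟩
  have hcons : ∀ a b, IsRay T a → IsRay T b → a < b → (∀ x : ℤ, a < x → x < b → ¬ IsRay T x) →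
      F b = F a + m := by
    intro a b ha hb hab hno
    have h := hT.2.2.2.2 a b ha hb hab hno
    rw [card_uncov] at h
    have h' := count_chain (fun x => ¬ Covered T x) F 1 b (T_ray hn hT b hb)
      (hunc b (T_ray hn hT b hb)) (b-a).toNat a (T_ray hn hT a ha) hab.le (by omega)
    rw [h] at h'
    push_cast at h'
    linarith
  have hnextray : ∀ x, IsRay T x → ∀ q, IsRay T q → x < q →
      ∃ x', x < x' ∧ x' ≤ q ∧ IsRay T x' ∧ F x' = F x + m ∧ ∀ y, x < y → y < x' → ¬ IsRay T y := by
    intro x hx q hq hxq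
    obtain ⟨x', ⟨k1, k2⟩, k3⟩ := Int.exists_least_of_bdd (P := fun z => x < z ∧ IsRay T z)
      ⟨x, fun z hz => hz.1.le⟩ ⟨q, hxq, hq⟩
    have hno : ∀ y, x < y → y < x' → ¬ IsRay T y := by
      intro y h1 h2 h3
      have := k3 y ⟨h1, h3⟩
      omega
    exact ⟨x', k1, k3 q ⟨hxq, hq⟩, k2, hcons x x' hx k2 k1 hno, hno⟩
  obtain ⟨a0, ha0⟩ : ∃ a, IsRay T a := by
    obtain ⟨i, hi⟩ := hT.2.2.1
    exact ⟨_, (spoke_mem_iff hn T i).1 hi⟩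
  have ha1 : IsRay T (a0 + n) := (isRay_per hn T a0).2 ha0
  have hdrift : (n : ℤ) - m * GG f n = m * s := by
    have h := count_chain (IsRay T) F m (a0+n) ha1 (fun x hx hxq => hnextray x hx (a0+n) ha1 hxq)
      n a0 ha0 (by omega) (by omega)
    have hcard : ((Finset.Icc a0 (a0+n)).filter (IsRay T)).card = s + 1 := by
      rw [← hsc, spokeCount_eq hn T a0]
      have : (Finset.Icc a0 (a0+n)).filter (IsRay T) =
          insert (a0 + (n:ℤ)) ((Finset.Ico a0 (a0+n)).filter (IsRay T)) := by
        ext y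
        simp only [Finset.mem_filter, Finset.mem_Icc, Finset.mem_Ico, Finset.mem_insert]
        constructor
        · rintro ⟨h1, h2⟩
          by_cases hy : y = a0 + n
          · exact Or.inl hy
          · exact Or.inr ⟨by omega, h2⟩
        · rintro (rfl | h)
          · exact ⟨by omega, ha1⟩
          · exact ⟨by omega, h.2⟩
      rw [this, Finset.card_insert_of_notMem (by simp)]
    rw [hcard, hper] at h
    push_cast at h
    linarith
  have hg : Good F f m n (m * s) :=
    ⟨hm, by omega, by positivity, fun x => by rw [hper, hdrift], hFs⟩
  have hCR := PA_CR h1 hg hPA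
  have hcov : ∀ x, Covered T x ↔ ¬ Rec F x := by
    intro x
    rw [← CR_covered hg]
    unfold Covered
    simp only [hCR]
  refine ⟨F a0, hg, hCR, ?_, hdrift⟩
  have hrayrec : ∀ x, IsRay T x → Rec F x := by
    intro x hx
    by_contra hc
    exact T_ray hn hT x hx ((hcov x).2 hc)
  have hcong : ∀ k : ℕ, ∀ a b, IsRay T a → IsRay T b → a ≤ b → b - a ≤ k → (m : ℤ) ∣ F b - F a := by
    intro k
    induction k with
    | zero =>
      intro a b _ _ h3 h4
      have : a = b := by push_cast at h4; omega
      subst this; simp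
    | succ k ih =>
      intro a b ha hb hab hk
      push_cast at hk
      rcases eq_or_lt_of_le hab with h | h
      · subst h; simp
      · obtain ⟨x', k1, k2, k3, k4, _⟩ := hnextray a ha b hb h
        have := ih x' b k3 hb k2 (by omega)
        rw [k4] at this
        have := dvd_add this (dvd_refl (m:ℤ))
        rwa [show F b - (F a + m) + m = F b - F a by ring] at this
  have hcong2 : ∀ a b, IsRay T a → IsRay T b → (m : ℤ) ∣ F b - F a := by
    intro a b ha hb
    rcases le_total a b with h | h
    · exact hcong (b-a).toNat a b ha hb h (by omega)
    · rw [← neg_sub]; exact (dvd_neg).2 (hcong (a-b).toNat b a hb ha h (by omega))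
  have hrmul : ∀ t : ℤ, IsRay T (a0 + t * n) := by
    intro t
    rw [isRay_iff hn, cls_add_mul, ← isRay_iff hn]; exact ha0
  intro x
  constructor
  · intro hx
    exact ⟨hrayrec x hx, hcong2 a0 x ha0 hx⟩
  · rintro ⟨hx, hdv⟩
    obtain ⟨a, ⟨ha, hax⟩, hamax⟩ := Int.exists_greatest_of_bdd (P := fun z => IsRay T z ∧ z ≤ x)
      ⟨x, fun z hz => hz.2⟩ ⟨a0 + (-|x - a0|) * n, hrmul _, by
        have := neg_abs_le (x - a0)
        have := abs_nonneg (x - a0)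
        nlinarith⟩
    have hq : IsRay T (a + n) := (isRay_per hn T a).2 ha
    obtain ⟨b, b1, b2, b3, b4, b5⟩ := hnextray a ha (a+n) hq (by omega)
    have hxb : x < b := by
      by_contra hc
      have := hamax b ⟨b3, by omega⟩
      omega
    rcases eq_or_lt_of_le hax with h | h
    · subst h; exact ha
    · exfalso
      have e1 := hx a h
      have e2 := hrayrec b b3 x hxb
      have e3 : (m : ℤ) ∣ F a - F x := by
        have := dvd_sub (hcong2 a0 a ha0 ha) hdv
        rwa [show F a - F a0 - (F x - F a0) = F a - F x by ring] at this
      have := dvd_lt_le e3 e1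
      omega

end ArcPart


section BuildPart
open Finset

open Classical in
noncomputable def mkT (n m : ℕ) (F : ℤ → ℤ) (r : ℤ) : Finset (PArc n) :=
  ((Finset.univ : Finset (Fin n)).filter
    (fun i => Rec F (i.val : ℤ) ∧ (m : ℤ) ∣ F (i.val : ℤ) - r)).image PArc.spoke ∪
  ((Finset.univ : Finset (Fin n × Fin n)).filter
    (fun p => CR F m (p.1.val : ℤ) ((p.1.val : ℤ) + PArc.len n p.1 p.2))).image
      (fun p => PArc.per p.1 p.2)

theorem spoke_mkT (n m : ℕ) (F : ℤ → ℤ) (r : ℤ) (i : Fin n) :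
    PArc.spoke i ∈ mkT n m F r ↔ Rec F (i.val : ℤ) ∧ (m : ℤ) ∣ F (i.val : ℤ) - r := by
  simp [mkT]

theorem per_mkT (n m : ℕ) (F : ℤ → ℤ) (r : ℤ) (i j : Fin n) :
    PArc.per i j ∈ mkT n m F r ↔ CR F m (i.val : ℤ) ((i.val : ℤ) + PArc.len n i j) := by
  simp [mkT]

theorem Rec_per {F : ℤ → ℤ} {p E : ℤ} (h : ∀ x, F (x+p) = F x + E) (x : ℤ) :
    Rec F (x+p) ↔ Rec F x := by
  constructor
  · intro hr y hy
    have := hr (y+p) (by omega)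
    rw [h, h] at this
    omega
  · intro hr y hy
    have h1 := hr (y-p) (by omega)
    have h2 := h (y-p)
    rw [sub_add_cancel] at h2
    rw [h2, h]
    omega

theorem CR_per {F : ℤ → ℤ} {m : ℕ} {p E : ℤ} (h : ∀ x, F (x+p) = F x + E) (a b : ℤ) :
    CR F m (a+p) (b+p) ↔ CR F m a b := by
  unfold CR
  rw [h, h, show F b + E - (F a + E) - 1 = F b - F a - 1 by ring]
  constructor
  · rintro ⟨h1, h2, h3, h4⟩
    refine ⟨by omega, by omega, h3, fun y hy1 hy2 => ?_⟩
    have := h4 (y+p) (by omega) (by omega)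
    rw [h] at this; omega
  · rintro ⟨h1, h2, h3, h4⟩
    refine ⟨by omega, by omega, h3, fun y hy1 hy2 => ?_⟩
    have k1 := h4 (y-p) (by omega) (by omega)
    have k2 := h (y-p)
    rw [sub_add_cancel] at k2
    omega

variable {F : ℤ → ℤ} {f : ℤ → ℕ} {m n s : ℕ}

theorem mul_per (g : Good F f m n (m * s)) (t x : ℤ) : F (x + t * n) = F x + t * (m * s) :=
  per_mul F n (m*s) g.hp x t

theorem isRay_mkT (hn : 0 < n) (g : Good F f m n (m * s)) (r x : ℤ) :
    IsRay (mkT n m F r) x ↔ Rec F x ∧ (m : ℤ) ∣ F x - r := by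
  have hx : ((cls n hn x).val : ℤ) + (x / n) * n = x := by
    rw [cls_val]; have := Int.emod_add_mul_ediv x n; linarith
  rw [isRay_iff hn, spoke_mkT]
  have h1 := Rec_per (p := (x / n) * n) (E := (x / n) * (m * s)) (mul_per g (x/n)) (cls n hn x).val
  have h2 := mul_per g (x/n) (cls n hn x).val
  rw [hx] at h1 h2
  rw [← h1, h2]
  have : F ((cls n hn x).val : ℤ) + x / ↑n * (↑m * ↑s) - r = F ((cls n hn x).val : ℤ) - r + m * (x / n * s) := by ring
  rw [this, dvd_add_left (dvd_mul_right _ _)]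

theorem isChord_mkT (hn : 0 < n) (g : Good F f m n (m * s)) (r a b : ℤ) :
    IsChord (mkT n m F r) a b ↔ CR F m a b := by
  have key : 0 < b - a → b - a ≤ n →
      (PArc.per (cls n hn a) (cls n hn b) ∈ mkT n m F r ↔ CR F m a b) := by
    intro k1 k2
    rw [per_mkT, len_cls hn a b k1 k2]
    have hx : ((cls n hn a).val : ℤ) + (a / n) * n = a := by
      rw [cls_val]; have := Int.emod_add_mul_ediv a n; linarith
    rw [← CR_per (p := (a / n) * n) (E := (a / n) * (m * s)) (mul_per g (a/n)), hx,
      show ((cls n hn a).val : ℤ) + (b - a) + (a / n) * n =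
        ((cls n hn a).val : ℤ) + (a / n) * n + (b - a) by ring, hx, add_sub_cancel]
  rw [isChord_iff hn]
  constructor
  · rintro ⟨h, k1, k2⟩; exact (key k1 k2).1 h
  · intro h
    have := CR_C1 g a b h
    exact ⟨(key (by omega) (by omega)).2 h, by omega, by omega⟩

theorem covered_mkT (hn : 0 < n) (g : Good F f m n (m * s)) (r x : ℤ) :
    Covered (mkT n m F r) x ↔ ¬ Rec F x := by
  rw [← CR_covered g]
  unfold Covered
  simp only [isChord_mkT hn g]

theorem mkT_not_cross (hn : 0 < n) (g : Good F f m n (m * s)) (r : ℤ) (i j k l : Fin n)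
    (h1 : PArc.per i j ∈ mkT n m F r) (h2 : PArc.per k l ∈ mkT n m F r) :
    ¬ (0 < PArc.gp n i k ∧ PArc.gp n i k < PArc.len n i j ∧
      PArc.len n i j < PArc.gp n i k + PArc.len n k l) := by
  rintro ⟨c1, c2, c3⟩
  have hk : cls n hn ((i.val : ℤ) + PArc.gp n i k) = k := by
    have h := gp_cast hn (i.val : ℤ) (k.val : ℤ)
    rw [cls_fin, cls_fin] at h
    unfold PArc.gp
    rw [h]
    conv_rhs => rw [← cls_fin hn k]
    rw [cls_eq]; simp
  have hl : cls n hn ((i.val : ℤ) + PArc.gp n i k + PArc.len n k l) = l := by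
    conv_rhs => rw [← cls_len hn k l]
    conv_rhs => rw [← hk]
    rw [cls_eq, cls_val, Int.emod_add_emod, hk]
  have lp := len_pos hn k l
  have h3 : IsChord (mkT n m F r) ((i.val : ℤ) + PArc.gp n i k)
      ((i.val : ℤ) + PArc.gp n i k + PArc.len n k l) := by
    rw [isChord_iff hn, hk, hl]
    exact ⟨h2, by omega, by omega⟩
  have h4 := (per_mem_iff hn _ i j).1 h1
  rw [isChord_mkT hn g] at h3 h4
  have := CR_NC _ _ _ _ h4 h3 (by omega) (by omega)
  omega

theorem mkT_not_cross' (hn : 0 < n) (g : Good F f m n (m * s)) (r : ℤ) (i j k : Fin n)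
    (h1 : PArc.per i j ∈ mkT n m F r) (h2 : PArc.spoke k ∈ mkT n m F r) :
    ¬ (0 < PArc.gp n i k ∧ PArc.gp n i k < PArc.len n i j) := by
  rintro ⟨c1, c2⟩
  have hk : cls n hn ((i.val : ℤ) + PArc.gp n i k) = k := by
    have h := gp_cast hn (i.val : ℤ) (k.val : ℤ)
    rw [cls_fin, cls_fin] at h
    unfold PArc.gp
    rw [h]
    conv_rhs => rw [← cls_fin hn k]
    rw [cls_eq]; simp
  have h3 : IsRay (mkT n m F r) ((i.val : ℤ) + PArc.gp n i k) := by
    rw [isRay_iff hn, hk]; exact h2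
  have h4 := (per_mem_iff hn _ i j).1 h1
  rw [isRay_mkT hn g] at h3
  exact (covered_mkT hn g r _).1 ⟨_, _, h4, by omega, by omega⟩ h3.1

theorem mkT_angulation (hn : 0 < n) (g : Good F f m n (m * s)) (r : ℤ) :
    IsAngulation n m (mkT n m F r) := by
  classical
  have hmz : (0 : ℤ) < m := by exact_mod_cast g.hm
  have hC : IsChord (mkT n m F r) = CR F m := by
    funext a b; exact propext (isChord_mkT hn g r a b)
  refine ⟨?_, ?_, ?_, ?_, ?_⟩
  · intro a ha
    cases a with
    | spoke i => trivial
    | per i j =>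
      rw [per_mkT] at ha
      have := (CR_C1 g _ _ ha).1
      show 2 ≤ PArc.len n i j
      omega
  · intro a ha b hb _
    cases a with
    | spoke i =>
      cases b with
      | spoke j => exact fun h => h
      | per k l => exact mkT_not_cross' hn g r k l i hb ha
    | per i j =>
      cases b with
      | spoke k => exact mkT_not_cross' hn g r i j k ha hb
      | per k l =>
        rintro (h | h)
        · exact mkT_not_cross hn g r i j k l ha hb h
        · exact mkT_not_cross hn g r k l i j hb ha h
  · obtain ⟨x, hx1, hx2⟩ := rec_exists F n (m*s) g.hn g.hD g.hp g.skip r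
    exact ⟨cls n hn x, (isRay_iff hn _ x).1 ((isRay_mkT hn g r x).2 ⟨hx2, by rw [hx1]; simp⟩)⟩
  · intro S hS
    have hS' : FinFace (IsChord (mkT n m F r)) S := hS
    rw [hC] at hS'
    obtain ⟨a, e, hae, rfl⟩ := face_S0 CR_NC hS'
    exact CR_face g hae
  · intro a b ha hb hab hno
    rw [card_uncov]
    rw [isRay_mkT hn g] at ha hb
    obtain ⟨x', k1, k2, k3, k4, _⟩ := rec_step F n (m*s) g.hn g.hD g.hp g.skip m r hmz b hb.1 hb.2 a ha hab
    have hxb : x' = b := by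
      by_contra hne
      exact hno x' k1 (by omega) ((isRay_mkT hn g r x').2 k3)
    subst hxb
    have h := rec_count F n (m*s) g.hn g.hD g.hp g.skip 1 0 one_pos a x' ha.1 (one_dvd _) hb.1 (one_dvd _)
      hab.le
    have heq : (Finset.Icc a x').filter (fun x => ¬ Covered (mkT n m F r) x) =
        (Finset.Icc a x').filter (fun x => Rec F x ∧ (1:ℤ) ∣ F x - 0) := by
      apply Finset.filter_congr
      intro y _
      rw [covered_mkT hn g]
      simp
    rw [heq]
    have : ((((Finset.Icc a x').filter (fun x => Rec F x ∧ (1:ℤ) ∣ F x - 0)).card : ℕ) : ℤ) = ((m + 1 : ℕ) : ℤ) := by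
      push_cast
      linarith
    exact_mod_cast this

theorem mkT_spokes (hn : 0 < n) (g : Good F f m n (m * s)) (r : ℤ) :
    spokeCount (mkT n m F r) = s := by
  classical
  have hmz : (0 : ℤ) < m := by exact_mod_cast g.hm
  obtain ⟨x, hx1, hx2⟩ := rec_exists F n (m*s) g.hn g.hD g.hp g.skip r
  have hxr : IsRay (mkT n m F r) x := (isRay_mkT hn g r x).2 ⟨hx2, by rw [hx1]; simp⟩
  have hxn := (isRay_per hn _ x).2 hxr
  rw [spokeCount_eq hn _ x]
  have h1 := (isRay_mkT hn g r x).1 hxr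
  have h2 := (isRay_mkT hn g r _).1 hxn
  have h := rec_count F n (m*s) g.hn g.hD g.hp g.skip m r hmz x (x+n) h1.1 h1.2 h2.1 h2.2 (by omega)
  have : (Finset.Icc x (x+n)).filter (fun x => Rec F x ∧ (m:ℤ) ∣ F x - r) =
      insert (x + (n:ℤ)) ((Finset.Ico x (x+n)).filter (IsRay (mkT n m F r))) := by
    ext y
    simp only [Finset.mem_filter, Finset.mem_Icc, Finset.mem_Ico, Finset.mem_insert, isRay_mkT hn g]
    constructor
    · rintro ⟨h1, h2⟩
      by_cases hy : y = x + n
      · exact Or.inl hy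
      · exact Or.inr ⟨by omega, h2⟩
    · rintro (rfl | h)
      · exact ⟨by omega, h2⟩
      · exact ⟨by omega, h.2⟩
  rw [this, Finset.card_insert_of_notMem (by simp), g.hp] at h
  push_cast at h
  have h3 : (m : ℤ) * (((Finset.Ico x (x+n)).filter (IsRay (mkT n m F r))).card : ℤ) = m * s := by
    linarith
  exact_mod_cast mul_left_cancel₀ hmz.ne' h3


theorem cls_sub (hn : 0 < n) (N : ℕ) (a : ℤ) (h : N % n < n) :
    cls n hn (a + N) - (⟨N % n, h⟩ : Fin n) = cls n hn a := by
  apply Fin.ext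
  have h1 := (cls n hn (a+N)).isLt
  rw [Fin.sub_def]
  have h2 : (((n - N % n + (cls n hn (a+N)).val) % n : ℕ) : ℤ) = ((cls n hn a).val : ℤ) := by
    rw [Int.natCast_mod, cls_val]
    push_cast [Nat.cast_sub h.le]
    rw [cls_val, Int.add_emod_emod]
    apply Int.emod_eq_emod_iff_emod_sub_eq_zero.2
    apply Int.emod_eq_zero_of_dvd
    have := Int.emod_add_mul_ediv N n
    exact ⟨1 + N / n, by linarith⟩
  exact_mod_cast h2

theorem rot_inj (c : Fin n) : Function.Injective (rotArc c) := by
  intro x y h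
  have : NeZero n := ⟨by have := c.isLt; omega⟩
  cases x <;> cases y <;> simp_all [rotArc]

theorem rot_fixed_iff (hn : 0 < n) (N : ℕ) (h : N % n < n) (T : Finset (PArc n)) :
    T.image (rotArc ⟨N % n, h⟩) = T ↔
      (∀ a b, IsChord T (a + N) (b + N) ↔ IsChord T a b) ∧ (∀ x, IsRay T (x + N) ↔ IsRay T x) := by
  constructor
  · intro heq
    constructor
    · intro a b
      rw [isChord_iff hn, isChord_iff hn, show b + (N:ℤ) - (a + N) = b - a by ring]
      apply and_congr_left
      intro _
      rw [← Function.Injective.mem_finset_image (rot_inj (⟨N % n, h⟩ : Fin n)), heq]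
      simp only [rotArc]
      rw [cls_sub hn, cls_sub hn]
    · intro x
      rw [isRay_iff hn, isRay_iff hn,
        ← Function.Injective.mem_finset_image (rot_inj (⟨N % n, h⟩ : Fin n)), heq]
      simp only [rotArc]
      rw [cls_sub hn]
  · rintro ⟨h1, h2⟩
    apply Finset.eq_of_subset_of_card_le
    · intro y hy
      rw [Finset.mem_image] at hy
      obtain ⟨x, hx, rfl⟩ := hy
      cases x with
      | spoke i =>
        rw [spoke_mem_iff hn, show (i.val : ℤ) = (i.val - N : ℤ) + N by ring, h2, isRay_iff hn] at hx
        have := cls_sub hn N (i.val - N : ℤ) h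
        rw [sub_add_cancel, cls_fin] at this
        simp only [rotArc]
        rw [this]; exact hx
      | per i j =>
        rw [per_mem_iff hn, show (i.val : ℤ) + PArc.len n i j = (i.val + PArc.len n i j - N : ℤ) + N by ring,
          show (i.val : ℤ) = (i.val - N : ℤ) + N by ring] at hx
        rw [show ((i.val:ℤ) - N + N + PArc.len n i j - N + N : ℤ) = (i.val + PArc.len n i j - N : ℤ) + N by ring,
          h1, isChord_iff hn] at hx
        have t1 := cls_sub hn N (i.val - N : ℤ) h
        have t2 := cls_sub hn N (i.val + PArc.len n i j - N : ℤ) h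
        rw [sub_add_cancel, cls_fin] at t1
        rw [sub_add_cancel, cls_len] at t2
        simp only [rotArc]
        rw [t1, t2]; exact hx.1
    · rw [Finset.card_image_of_injective _ (rot_inj _)]

end BuildPart


section FinalPart
open Finset

theorem GG_mul (f : ℤ → ℕ) (p : ℤ) (hf : ∀ x, f (x+p) = f x) (t : ℤ) : GG f (t * p) = t * GG f p := by
  have h : ∀ x, GG f (x+p) = GG f x + GG f p := by
    intro x
    have := FF_add 1 f p hf x
    unfold FF at this
    push_cast at this
    linarith
  have h1 := per_mul (GG f) p (GG f p) h 0 t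
  have h0 : GG f 0 = 0 := by simp [GG]
  rw [zero_add, h0, zero_add] at h1
  exact h1

def fg {N : ℕ} (hN : 0 < N) (g : Fin N → ℕ) (x : ℤ) : ℕ := g (cls N hN x)

theorem fg_per {N : ℕ} (hN : 0 < N) (g : Fin N → ℕ) (x t : ℤ) : fg hN g (x + t * N) = fg hN g x := by
  unfold fg; rw [cls_add_mul]

theorem GG_nat (f : ℤ → ℕ) (N : ℕ) : GG f N = ∑ i ∈ Finset.range N, (f i : ℤ) := by
  induction N with
  | zero => simp [GG]
  | succ N ih => rw [Finset.sum_range_succ, ← ih]; push_cast; rw [GG_succ]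

theorem GG_fg {N : ℕ} (hN : 0 < N) (g : Fin N → ℕ) : GG (fg hN g) N = ((∑ i, g i : ℕ) : ℤ) := by
  rw [GG_nat, Finset.sum_range]
  push_cast
  apply Finset.sum_congr rfl
  intro i _
  unfold fg; rw [cls_fin]

theorem card_comp (N K : ℕ) (hN : 0 < N) :
    Nat.card {g : Fin N → ℕ // ∑ i, g i = K} = (N + K - 1).choose (N - 1) := by
  rw [Nat.card_congr (Sym.equivNatSumOfFintype (Fin N) K).symm, Nat.card_eq_fintype_card,
    Sym.card_sym_eq_choose, Fintype.card_fin]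
  exact Nat.choose_symm_of_eq_add (by omega)

theorem fg_good {N m d s K : ℕ} (hN : 0 < N) (hm : 0 < m) (hd : 0 < d) (hs : 0 < s)
    (hNe : N = m * s + m * K) (g : Fin N → ℕ) (hg : ∑ i, g i = K) :
    Good (FF m (fg hN g)) (fg hN g) m ((d * N : ℕ) : ℤ) (m * (d * s : ℕ)) := by
  refine ⟨hm, by positivity, by positivity, ?_, FF_succ m _⟩
  have hp : ∀ x, fg hN g (x + ((d * N : ℕ) : ℤ)) = fg hN g x := by
    intro x; push_cast; exact fg_per hN g x d
  intro x
  rw [FF_add m _ _ hp]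
  have h1 : GG (fg hN g) ((d * N : ℕ) : ℤ) = d * K := by
    push_cast
    rw [GG_mul _ _ (fun x => by simpa using fg_per hN g x 1), GG_fg, hg]
  rw [h1]
  have hz : (N : ℤ) = m * s + m * K := by exact_mod_cast hNe
  push_cast
  linear_combination (d : ℤ) * hz

theorem fg_shift {N m s K : ℕ} (hN : 0 < N) 
    (hNe : N = m * s + m * K) (g : Fin N → ℕ) (hg : ∑ i, g i = K) (x : ℤ) :
    FF m (fg hN g) (x + N) = FF m (fg hN g) x + m * s := by
  rw [FF_add m _ _ (fun x => by simpa using fg_per hN g x 1), GG_fg, hg]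
  have : (N : ℤ) = m * s + m * K := by exact_mod_cast hNe
  linarith

theorem fixed_count {N m d s K n : ℕ} (hN : 0 < N) (hm : 0 < m) (hd : 0 < d) (hs : 0 < s)
    (hNe : N = m * s + m * K) (hnd : n = d * N) (hlt : N % n < n) :
    Nat.card {T : Finset (PArc n) // IsAngulation n m T ∧ spokeCount T = d * s ∧
      T.image (rotArc ⟨N % n, hlt⟩) = T} = m * (N + K - 1).choose (N - 1) := by
  subst hnd
  have hn : 0 < d * N := Nat.mul_pos hd hN
  have hmz : (0 : ℤ) < m := by exact_mod_cast hm
  have hgood := fun g hg => fg_good hN hm hd hs hNe g hg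
  let Ψ : {g : Fin N → ℕ // ∑ i, g i = K} × Fin m →
      {T : Finset (PArc (d*N)) // IsAngulation (d*N) m T ∧ spokeCount T = d * s ∧
        T.image (rotArc ⟨N % (d*N), hlt⟩) = T} := fun p =>
    ⟨mkT (d*N) m (FF m (fg hN p.1.1)) (p.2.val : ℤ), mkT_angulation hn (hgood p.1.1 p.1.2) _,
      mkT_spokes hn (hgood p.1.1 p.1.2) _, by
        have gd := hgood p.1.1 p.1.2
        have hsh := fg_shift hN hNe p.1.1 p.1.2
        rw [rot_fixed_iff hn]
        constructor
        · intro a b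
          rw [isChord_mkT hn gd, isChord_mkT hn gd, CR_per hsh]
        · intro x
          rw [isRay_mkT hn gd, isRay_mkT hn gd, Rec_per hsh, hsh,
            show FF m (fg hN p.1.1) x + m * s - p.2.val = FF m (fg hN p.1.1) x - p.2.val + m * s by ring,
            dvd_add_left (dvd_mul_right _ _)]⟩
  have hbij : Function.Bijective Ψ := by
    constructor
    · rintro ⟨⟨g, hg⟩, r⟩ ⟨⟨g', hg'⟩, r'⟩ h
      have h0 : mkT (d*N) m (FF m (fg hN g)) (r.val : ℤ) = mkT (d*N) m (FF m (fg hN g')) (r'.val : ℤ) :=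
        congrArg Subtype.val h
      have gd := hgood g hg
      have gd' := hgood g' hg'
      have hC : CR (FF m (fg hN g)) m = CR (FF m (fg hN g')) m := by
        funext a b
        apply propext
        rw [← isChord_mkT hn gd r.val, h0, isChord_mkT hn gd']
      have hf : ∀ x, fg hN g x = fg hN g' x := by
        intro x
        rw [← cnt_CR gd, ← cnt_CR gd', hC]
      have hgg : g = g' := by
        funext i
        have := hf i.val
        unfold fg at this
        rwa [cls_fin] at this
      subst hgg
      obtain ⟨x, hx1, hx2⟩ := rec_exists _ _ _ gd.hn gd.hD gd.hp gd.skip r.val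
      have h1 := (isRay_mkT hn gd r.val x).2 ⟨hx2, by rw [hx1]; simp⟩
      rw [h0, isRay_mkT hn gd, hx1] at h1
      have h2 := Int.eq_zero_of_abs_lt_dvd h1.2 (by
        have := r.isLt
        have := r'.isLt
        rw [abs_lt]; omega)
      have : r = r' := Fin.ext (by omega)
      subst this; rfl
    · rintro ⟨T, hT, hsc, hrot⟩
      obtain ⟨r, gd, h1, h2, h3⟩ := T_struct hn hm (Nat.mul_pos hd hs) hT hsc
      rw [rot_fixed_iff hn] at hrot
      have hper : ∀ x, cnt (IsChord T) (d*N : ℕ) (x + N) = cnt (IsChord T) (d*N : ℕ) x :=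
        cnt_per hrot.1
      have hperm : ∀ x t : ℤ, cnt (IsChord T) (d*N : ℕ) (x + t * N) = cnt (IsChord T) (d*N : ℕ) x := by
        intro x t
        have := per_mul (fun x => (cnt (IsChord T) (d*N : ℕ) x : ℤ)) N 0 (fun x => by
          simp only [hper, add_zero]) x t
        simp only [mul_zero, add_zero] at this
        exact_mod_cast this
      have hfeq : fg hN (fun i : Fin N => cnt (IsChord T) (d*N : ℕ) i.val) = cnt (IsChord T) (d*N : ℕ) := by
        funext x
        show cnt (IsChord T) (d*N : ℕ) ((cls N hN x).val : ℤ) = _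
        have h := hperm ((cls N hN x).val : ℤ) (x / N)
        rw [← h]
        congr 1
        rw [cls_val]
        have := Int.emod_add_mul_ediv x N
        linarith
      have hsum : ∑ i : Fin N, cnt (IsChord T) (d*N : ℕ) i.val = K := by
        have e1 := GG_fg hN (fun i : Fin N => cnt (IsChord T) (d*N : ℕ) i.val)
        have e2 := GG_mul _ _ hper d
        rw [hfeq] at e1
        have hdn : (d : ℤ) * N = ((d * N : ℕ) : ℤ) := by push_cast; ring
        rw [hdn, e1] at e2
        rw [e2] at h3
        have hz : (N : ℤ) = m * s + m * K := by exact_mod_cast hNe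
        have hds : ((d * s : ℕ) : ℤ) = d * s := by push_cast; ring
        rw [hds] at h3
        have hdz : (0 : ℤ) < d := by exact_mod_cast hd
        have hdm : (d : ℤ) * m ≠ 0 := by positivity
        generalize (∑ i : Fin N, cnt (IsChord T) ((d * N : ℕ) : ℤ) i.val) = S at h3 ⊢
        rw [← hdn] at h3
        have h4 : (d : ℤ) * m * (S : ℤ) = d * m * K := by
          linear_combination (d : ℤ) * hz - h3
        exact_mod_cast mul_left_cancel₀ hdm h4
      have hrm := Int.emod_nonneg r hmz.ne'
      have hrl := Int.emod_lt_of_pos r hmz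
      refine ⟨⟨⟨_, hsum⟩, ⟨(r % m).toNat, by omega⟩⟩, ?_⟩
      apply Subtype.ext
      show mkT (d*N) m (FF m (fg hN (fun i : Fin N => cnt (IsChord T) (d*N : ℕ) i.val))) 
        (((r % m).toNat : ℕ) : ℤ) = T
      rw [hfeq, Int.toNat_of_nonneg hrm]
      apply arcs_ext hn
      · intro a b
        rw [isChord_mkT hn gd, h1]
      · intro x
        rw [isRay_mkT hn gd, h2]
        have e1 : (m : ℤ) ∣ r - r % m := Int.dvd_self_sub_emod
        rw [show FF m (cnt (IsChord T) (d*N : ℕ)) x - r % m =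
          (FF m (cnt (IsChord T) (d*N : ℕ)) x - r) + (r - r % m) by ring, dvd_add_left e1]
  rw [← Nat.card_congr (Equiv.ofBijective Ψ hbij), Nat.card_prod, card_comp N K hN, Nat.card_fin, mul_comm]

theorem fixed_dvd {N m d s l n : ℕ} (hN : 0 < N) (hm : 0 < m) (hd : 0 < d) (hs : 0 < s) (hsl : s ≤ l)
    (hnl : n = m * l) (hnd : n = d * N) (hlt : N % n < n) (T : Finset (PArc n))
    (hT : IsAngulation n m T) (hsc : spokeCount T = s)
    (hrot : T.image (rotArc ⟨N % n, hlt⟩) = T) : d ∣ l - s := by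
  have hn : 0 < n := by rw [hnd]; positivity
  obtain ⟨r, gd, h1, h2, h3⟩ := T_struct hn hm hs hT hsc
  rw [rot_fixed_iff hn] at hrot
  have hper : ∀ x, cnt (IsChord T) n (x + N) = cnt (IsChord T) n x := cnt_per hrot.1
  have e2 := GG_mul _ _ hper d
  have hnz : (n : ℤ) = d * N := by exact_mod_cast hnd
  have hlz : (n : ℤ) = m * l := by exact_mod_cast hnl
  rw [← hnz] at e2
  rw [e2] at h3
  have hmz : (0 : ℤ) < m := by exact_mod_cast hm
  have h4 : (l : ℤ) - s = d * GG (cnt (IsChord T) n) N := by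
    apply mul_left_cancel₀ hmz.ne'
    linarith
  have : (d : ℤ) ∣ ((l - s : ℕ) : ℤ) := ⟨_, by rw [Nat.cast_sub hsl]; exact h4⟩
  exact_mod_cast this

end FinalPart

theorem stmt12 (m ℓ s d n : ℕ) (hm : 0 < m) (hl : 0 < ℓ) (hn : n = m * ℓ)
    (hs1 : 1 ≤ s) (hsl : s ≤ ℓ) (hd : 0 < d) (hdn : d ∣ n)
    (hcond : ¬ (s % d = ℓ % d ∧ s % d ≠ 0))
    (ζ : ℂ) (hζ : IsPrimitiveRoot ζ d) :
    (m : ℂ) * Polynomial.aeval ζ (qbinom (n + ℓ - s - 1) (n - 1))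
      = (Nat.card {T : Finset (PArc n) // IsAngulation n m T ∧ spokeCount T = s ∧
          T.image (rotArc ⟨n / d % n, Nat.mod_lt _ (by rw [hn]; exact Nat.mul_pos hm hl)⟩) = T}
        : ℂ) := by
  have hnpos : 0 < n := by rw [hn]; exact Nat.mul_pos hm hl
  have hN : 0 < n / d := Nat.div_pos (Nat.le_of_dvd hnpos hdn) hd
  have hnd : n = d * (n / d) := (Nat.mul_div_cancel' hdn).symm
  have hq : Polynomial.aeval ζ (qbinom (n + ℓ - s - 1) (n - 1)) = qb ζ (n + (ℓ - s) - 1) (n - 1) := by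
    unfold qb
    rw [show n + ℓ - s - 1 = n + (ℓ - s) - 1 by omega]
  rw [hq]
  have hnd' : n / d * d = n := Nat.div_mul_cancel hdn
  by_cases hdk : d ∣ ℓ - s
  · have hmod : s % d = ℓ % d := (Nat.modEq_iff_dvd' hsl).2 hdk
    have hds : d ∣ s := by
      apply Nat.dvd_of_mod_eq_zero
      by_contra hc
      exact hcond ⟨hmod, hc⟩
    obtain ⟨K, hK⟩ := hdk
    obtain ⟨s', rfl⟩ := hds
    have hs' : 0 < s' := Nat.pos_of_mul_pos_left hs1
    have hNe : n / d = m * s' + m * K := by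
      apply Nat.eq_of_mul_eq_mul_left hd
      rw [← hnd, hn, show ℓ = d * s' + d * K by omega]
      ring
    rw [fixed_count hN hm hd hs' hNe hnd]
    have h := qb_final_div ζ d hd hζ (n/d) K hN
    rw [hnd', mul_comm K d, ← hK] at h
    rw [h]
    push_cast; rfl
  · have h := qb_final_ndiv ζ d hd hζ (n/d) (ℓ - s) hN hdk
    rw [hnd'] at h
    rw [h, mul_zero]
    have hE : IsEmpty {T : Finset (PArc n) // IsAngulation n m T ∧ spokeCount T = s ∧
          T.image (rotArc ⟨n / d % n, Nat.mod_lt _ (by rw [hn]; exact Nat.mul_pos hm hl)⟩) = T} :=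
      ⟨fun T => hdk (fixed_dvd hN hm hd hs1 hsl hn hnd _ T.1 T.2.1 T.2.2.1 T.2.2.2)⟩
    rw [Nat.card_of_isEmpty]; simp
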